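/- arXiv:2409.12542 — 9 statements merged into one kernel-verified Lean document; each statement's English description precedes it below -/
import Mathlib

section
/- Let x ∈ ℂ^6 be nonzero with x_0 + x_1 + ⋯ + x_5 = 0. Then x represents a singular point of the Segre primal X_0 (i.e. x_0^3 + ⋯ + x_5^3 = 0 and x_0^2 = x_1^2 = ⋯ = x_5^2) if and only if there exist a nonzero λ ∈ ℂ and a 3-element subset S ⊆ {0,…,5} such that x_i = λ for i ∈ S and x_i = −λ for i ∉ S. In particular the singular points of X_0 are exactly the point [1,1,1,−1,−1,−1] and the points obtained from it by permuting the coordinates. -/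
/-- The sum of a function equal to `a` on `S` and to `-a` off `S`. -/
theorem Fintype.sum_ite_mem_neg {ι R : Type*} [Fintype ι] [DecidableEq ι] [CommRing R]
    (S : Finset ι) (a : R) :
    ∑ i, (if i ∈ S then a else -a) = (2 * (S.card : R) - Fintype.card ι) * a := by
  have h : ∀ i, (if i ∈ S then a else -a) = (if i ∈ S then 2 * a else 0) - a := by
    intro i
    split_ifs <;> ring
  simp only [h, Finset.sum_sub_distrib, Finset.sum_ite_mem, Finset.univ_inter, Finset.sum_const,
    Finset.card_univ, nsmul_eq_mul]
  ring

/-- Let `x ∈ ℂ^6` be nonzero with `x 0 + ⋯ + x 5 = 0`. Then `x` represents a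
singular point of the Segre primal `X₀` (i.e. `∑ xᵢ³ = 0` and all `xᵢ²` are equal) iff there are
a nonzero `λ ∈ ℂ` and a 3-element subset `S ⊆ {0,…,5}` with `xᵢ = λ` for `i ∈ S` and `xᵢ = -λ`
for `i ∉ S`. -/
theorem stmt_0 (x : Fin 6 → ℂ) (hx : x ≠ 0) (hsum : ∑ i, x i = 0) :
    (∑ i, x i ^ 3 = 0 ∧ ∀ i j, x i ^ 2 = x j ^ 2) ↔
      ∃ lam : ℂ, lam ≠ 0 ∧ ∃ S : Finset (Fin 6), S.card = 3 ∧
        ∀ i, x i = if i ∈ S then lam else -lam := by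
  constructor
  · rintro ⟨-, hsq⟩
    have h0 : x 0 ≠ 0 := by
      intro h
      refine hx (funext fun i => ?_)
      simpa [h] using hsq i 0
    have hS : ∀ i, x i = if i ∈ Finset.univ.filter (fun i => x i = x 0) then x 0 else -x 0 := by
      intro i
      rcases sq_eq_sq_iff_eq_or_eq_neg.mp (hsq i 0) with h | h <;> simp [h]
    refine ⟨x 0, h0, _, ?_, hS⟩
    rw [Finset.sum_congr rfl fun i _ => hS i, Fintype.sum_ite_mem_neg, mul_eq_zero,
      or_iff_left h0, Fintype.card_fin, sub_eq_zero] at hsum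
    have hcard : 2 * (Finset.univ.filter fun i => x i = x 0).card = 6 := by exact_mod_cast hsum
    lia
  · rintro ⟨a, -, S, -, hS⟩
    have hsq : ∀ i, x i ^ 2 = a ^ 2 := by
      intro i
      rw [hS i]
      split_ifs <;> ring
    refine ⟨?_, fun i j => by rw [hsq, hsq]⟩
    simp only [pow_succ _ 2, hsq, ← Finset.mul_sum, hsum, mul_zero]
end

section
/- The set of singular points of the Segre primal X_0, i.e. the set of points of ℙ(ℂ^6) represented by nonzero vectors x with Σ x_i = 0, Σ x_i^3 = 0 and x_0^2 = x_1^2 = ⋯ = x_5^2, has exactly 10 elements. -/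
/-- The vector with entry `1` at the indices in `s` and `-1` elsewhere. -/
def signVector (s : Finset (Fin 6)) : Fin 6 → ℂ := fun i => if i ∈ s then 1 else -1

lemma signVector_sq (s : Finset (Fin 6)) (i : Fin 6) : signVector s i ^ 2 = 1 := by
  unfold signVector; split_ifs <;> norm_num

lemma signVector_pow_three (s : Finset (Fin 6)) (i : Fin 6) :
    signVector s i ^ 3 = signVector s i := by
  rw [pow_succ, signVector_sq, one_mul]

lemma signVector_ne_zero (s : Finset (Fin 6)) : signVector s ≠ 0 := by
  intro h
  simpa [h] using signVector_sq s 0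

lemma sum_signVector (s : Finset (Fin 6)) : ∑ i, signVector s i = 2 * s.card - 6 := by
  have h (i : Fin 6) : signVector s i = 2 * (if i ∈ s then 1 else 0) - 1 := by
    unfold signVector; split_ifs <;> norm_num
  simp [h, mul_comm]

lemma signVector_eq_one_iff {s : Finset (Fin 6)} {i : Fin 6} :
    signVector s i = 1 ↔ i ∈ s := by
  unfold signVector; split_ifs with h <;> norm_num [h]

lemma signVector_injective : Function.Injective signVector := by
  intro s t h
  ext i
  rw [← signVector_eq_one_iff, h, signVector_eq_one_iff]

/-- The three-element subsets of `Fin 6` containing `0`. -/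
def triplesWithZero : Finset (Finset (Fin 6)) :=
  (Finset.univ.powersetCard 3).filter (0 ∈ ·)

lemma mem_triplesWithZero {s : Finset (Fin 6)} :
    s ∈ triplesWithZero ↔ s.card = 3 ∧ 0 ∈ s := by
  simp [triplesWithZero]

lemma card_triplesWithZero : triplesWithZero.card = 10 := by decide

/-- The projective point represented by a sign vector. -/
noncomputable def signPoint (s : Finset (Fin 6)) : Projectivization ℂ (Fin 6 → ℂ) :=
  Projectivization.mk ℂ (signVector s) (signVector_ne_zero s)

lemma signPoint_injOn : Set.InjOn signPoint {s | 0 ∈ s} := by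
  intro s (hs : 0 ∈ s) t (ht : 0 ∈ t) h
  obtain ⟨a, ha⟩ := (Projectivization.mk_eq_mk_iff' ..).1 h
  have ha1 : a = 1 := by simpa [signVector, hs, ht] using congrFun ha 0
  rw [ha1, one_smul] at ha
  exact (signVector_injective ha).symm

lemma exists_eq_smul_signVector {x : Fin 6 → ℂ} (h : ∀ i j, x i ^ 2 = x j ^ 2) :
    ∃ s : Finset (Fin 6), 0 ∈ s ∧ x = x 0 • signVector s := by
  classical
  refine ⟨Finset.univ.filter (x · = x 0), by simp, funext fun i => ?_⟩
  rcases sq_eq_sq_iff_eq_or_eq_neg.1 (h i 0) with hi | hi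
  · simp [signVector, hi]
  · by_cases h0 : x i = x 0
    · simp [signVector, h0]
    · simpa [signVector, h0] using hi

/-- The set of singular points of the Segre primal `X₀`, i.e. the points of
`ℙ(ℂ^6)` represented by nonzero vectors `x` with `∑ xᵢ = 0`, `∑ xᵢ³ = 0` and
`x₀² = x₁² = ⋯ = x₅²`, has exactly 10 elements. -/
theorem stmt_1 :
    {P : Projectivization ℂ (Fin 6 → ℂ) | ∃ x : Fin 6 → ℂ, ∃ hx : x ≠ 0,
      P = Projectivization.mk ℂ x hx ∧ ∑ i, x i = 0 ∧ ∑ i, x i ^ 3 = 0 ∧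
        ∀ i j, x i ^ 2 = x j ^ 2}.ncard = 10 := by
  rw [← card_triplesWithZero, ← Set.ncard_coe_finset, ← Set.InjOn.ncard_image
    (signPoint_injOn.mono fun s hs => (mem_triplesWithZero.1 hs).2)]
  congr 1
  ext P
  constructor
  · rintro ⟨x, hx, rfl, hsum, -, hsq⟩
    obtain ⟨s, hs, hxs⟩ := exists_eq_smul_signVector hsq
    have hx0 : x 0 ≠ 0 := fun h => hx (by rw [hxs, h, zero_smul])
    refine ⟨s, mem_triplesWithZero.2 ⟨?_, hs⟩,
      (Projectivization.mk_eq_mk_iff' ..).2 ⟨(x 0)⁻¹, ?_⟩⟩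
    · have hmul : x 0 * ∑ i, signVector s i = 0 := by
        rw [Finset.mul_sum, ← hsum]
        exact Finset.sum_congr rfl fun i _ => (congrFun hxs i).symm
      have hcard := (mul_eq_zero.1 hmul).resolve_left hx0
      rw [sum_signVector] at hcard
      have : (s.card : ℂ) = 3 := by linear_combination hcard / 2
      exact_mod_cast this
    · exact (inv_smul_eq_iff₀ hx0).2 hxs
  · rintro ⟨s, hs, rfl⟩
    have hsum : ∑ i, signVector s i = 0 := by
      rw [sum_signVector, (mem_triplesWithZero.1 hs).1]; norm_num
    exact ⟨signVector s, signVector_ne_zero s, rfl, hsum, by simpa [signVector_pow_three],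
      fun i j => by rw [signVector_sq, signVector_sq]⟩
end

section
/- Every projective 2-plane contained in the Segre primal X_0 is one of the 15 planes ℙ(P_M): if W ⊆ ℂ^6 is a 3-dimensional linear subspace such that every x ∈ W satisfies Σ x_i = 0 and Σ x_i^3 = 0, then W = P_M for some perfect matching M of {0,…,5}. In particular X_0 contains exactly 15 planes. -/
/-- A square matrix whose columns have the cubic Gram tensor of the standard basis and
sum to `1` is a permutation matrix. -/
theorem exists_perm_of_cubic_gram {ι K : Type*} [Fintype ι] [DecidableEq ι] [Field K]
    (M : Matrix ι ι K)
    (hM : ∀ a b c, ∑ j, M j a * M j b * M j c = if a = b ∧ b = c then 1 else 0)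
    (hsum : ∀ a, ∑ j, M j a = 1) :
    ∃ τ : Equiv.Perm ι, ∀ j a, M j a = if j = τ a then 1 else 0 := by
  have hleft : M.transpose * Matrix.of (fun j b => M j b * M j b) = 1 := by
    ext a b
    rw [Matrix.mul_apply, Matrix.one_apply]
    simpa [mul_assoc] using hM a b b
  have hright := mul_eq_one_comm.mp hleft
  have hzero : ∀ a b, a ≠ b → ∀ k, M k a * M k b = 0 := by
    intro a b hab k
    have hv : Matrix.vecMul (fun j => M j a * M j b) M = 0 := by
      ext c
      have := hM a b c
      rw [if_neg (fun h => hab h.1)] at this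
      simpa [Matrix.vecMul, dotProduct] using this
    have hunit : M * (Matrix.of (fun j b => M j b * M j b)).transpose = 1 := by
      rw [← Matrix.transpose_inj, Matrix.transpose_mul, Matrix.transpose_transpose,
        Matrix.transpose_one, hright]
    have h2 := congrArg
      (fun v => Matrix.vecMul v (Matrix.of (fun j b => M j b * M j b)).transpose) hv
    simp only [Matrix.vecMul_vecMul, hunit, Matrix.vecMul_one, Matrix.zero_vecMul] at h2
    exact congrFun h2 k
  have hex : ∀ a, ∃ j, M j a ≠ 0 := by
    intro a
    by_contra! h
    simpa [h] using hsum a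
  choose t ht using hex
  have hinj : Function.Injective t := by
    intro a b hab
    by_contra hne
    rcases mul_eq_zero.mp (hzero a b hne (t a)) with h | h
    · exact ht a h
    · exact ht b (hab ▸ h)
  let τ := Equiv.ofBijective t (Finite.injective_iff_bijective.mp hinj)
  have hoff : ∀ j a, j ≠ τ a → M j a = 0 := by
    intro j a hj
    have hne : τ.symm j ≠ a := fun h => hj (by rw [← h, Equiv.apply_symm_apply])
    have h1 : M j (τ.symm j) ≠ 0 := by
      have := ht (τ.symm j)
      rwa [show t (τ.symm j) = j from τ.apply_symm_apply j] at this
    exact (mul_eq_zero.mp (hzero _ _ hne j)).resolve_left h1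
  refine ⟨τ, fun j a => ?_⟩
  split_ifs with h
  · rw [h, ← hsum a, Finset.sum_eq_single (τ a) (fun j _ hj => hoff j a hj) (by simp)]
  · exact hoff j a h

/-- A subspace of `ι → K` of dimension `n` projects isomorphically onto some `n` coordinates. -/
theorem exists_coordinates {ι K : Type*} [Fintype ι] [Field K] {n : ℕ}
    (W : Submodule K (ι → K)) (hW : Module.finrank K W = n) :
    ∃ a : Fin n → ι, Function.Injective a ∧
      Function.Bijective (fun (x : W) (i : Fin n) => (x : ι → K) (a i)) := by
  let f : ι → Module.Dual K W := fun i => (LinearMap.proj i).comp W.subtype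
  obtain ⟨κ, a, ha, hspan, hli⟩ := exists_linearIndependent' K f
  have : Finite κ := Finite.of_injective a ha
  have := Fintype.ofFinite κ
  let g : W →ₗ[K] (κ → K) := LinearMap.pi fun k => f (a k)
  have hg : Function.Injective g := by
    rw [← LinearMap.ker_eq_bot, LinearMap.ker_eq_bot']
    intro x hx
    have hle : Submodule.span K (Set.range f) ≤ LinearMap.ker (Module.Dual.eval K W x) := by
      rw [← hspan, Submodule.span_le]
      rintro _ ⟨k, rfl⟩
      exact congrFun hx k
    ext i
    exact hle (Submodule.subset_span ⟨i, rfl⟩)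
  have h1 : Fintype.card κ ≤ n := by
    have := hli.fintype_card_le_finrank
    rwa [Subspace.dual_finrank_eq, hW] at this
  have h2 : n ≤ Fintype.card κ := by
    have := LinearMap.finrank_le_finrank_of_injective hg
    rwa [hW, Module.finrank_fintype_fun_eq_card] at this
  have hc := le_antisymm h1 h2
  let e : κ ≃ Fin n := Fintype.equivFinOfCardEq hc
  have hgb : Function.Bijective g := ⟨hg, (LinearMap.injective_iff_surjective_of_finrank_eq_finrank
    (by rw [hW, Module.finrank_fintype_fun_eq_card, hc])).mp hg⟩
  exact ⟨a ∘ e.symm, ha.comp e.symm.injective,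
    (Equiv.arrowCongr e (Equiv.refl K)).bijective.comp hgb⟩

/-- An injection of half the elements extends to an equivalence. -/
theorem exists_sum_equiv {n : ℕ} {ι : Type*} [Fintype ι] (hι : Fintype.card ι = n + n)
    (a : Fin n → ι) (ha : Function.Injective a) :
    ∃ e : Fin n ⊕ Fin n ≃ ι, ∀ i, e (Sum.inl i) = a i := by
  classical
  have hc : Fintype.card ((Set.range a)ᶜ : Set ι) = n := by
    rw [Fintype.card_compl_set, hι, Set.card_range_of_injective ha, Fintype.card_fin]
    omega
  exact ⟨(Equiv.sumCongr (Equiv.ofInjective a ha) (Fintype.equivFinOfCardEq hc).symm).trans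
    (Equiv.Set.sumCompl (Set.range a)), fun i => by simp⟩

/-- Polarization of the vanishing of the power sum cubic on a subspace. -/
theorem sum_mul_mul_eq_zero_of_sum_cube {ι K : Type*} [Fintype ι] [Field K] [CharZero K]
    (W : Submodule K (ι → K)) (h : ∀ x ∈ W, ∑ i, x i ^ 3 = 0) {u v w : ι → K}
    (hu : u ∈ W) (hv : v ∈ W) (hw : w ∈ W) : ∑ i, u i * v i * w i = 0 := by
  have key : 6 * ∑ i, u i * v i * w i =
      ∑ i, (u + v + w) i ^ 3 - ∑ i, (u + v) i ^ 3 - ∑ i, (u + w) i ^ 3 - ∑ i, (v + w) i ^ 3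
        + ∑ i, u i ^ 3 + ∑ i, v i ^ 3 + ∑ i, w i ^ 3 := by
    simp only [Finset.mul_sum, ← Finset.sum_add_distrib, ← Finset.sum_sub_distrib, Pi.add_apply]
    exact Finset.sum_congr rfl fun i _ => by ring
  rw [h _ (W.add_mem (W.add_mem hu hv) hw), h _ (W.add_mem hu hv), h _ (W.add_mem hu hw),
    h _ (W.add_mem hv hw), h _ hu, h _ hv, h _ hw] at key
  simpa using key

/-- A half-dimensional subspace on which the first and third power sums vanish is cut out by a
perfect matching of the coordinates. -/
theorem exists_matching_of_power_sums_eq_zero {ι K : Type*} [Fintype ι] [Field K] [CharZero K]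
    {n : ℕ} (hι : Fintype.card ι = n + n) (W : Submodule K (ι → K))
    (hW : Module.finrank K W = n) (h : ∀ x ∈ W, ∑ i, x i = 0 ∧ ∑ i, x i ^ 3 = 0) :
    ∃ σ : Equiv.Perm ι, (∀ i, σ i ≠ i) ∧ (∀ i, σ (σ i) = i) ∧
      ∀ x : ι → K, x ∈ W ↔ ∀ i, x i + x (σ i) = 0 := by
  obtain ⟨a, ha, hbij⟩ := exists_coordinates W hW
  obtain ⟨e, he⟩ := exists_sum_equiv hι a ha
  have hsplit : ∀ f : ι → K, ∑ i, f i = ∑ i, f (e (.inl i)) + ∑ i, f (e (.inr i)) := fun f => by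
    rw [← e.sum_comp, Fintype.sum_sum_type]
  choose b hb using fun k : Fin n => hbij.2 (Pi.single k 1)
  have hb' : ∀ k i, (b k : ι → K) (e (.inl i)) = if i = k then 1 else 0 := fun k i => by
    rw [he, ← Pi.single_apply]
    exact congrFun (hb k) i
  obtain ⟨τ, hτ⟩ := exists_perm_of_cubic_gram
    (Matrix.of fun j k => -(b k : ι → K) (e (.inr j)))
    (by
      intro p q r
      have := sum_mul_mul_eq_zero_of_sum_cube W (fun x hx => (h x hx).2) (b p).2 (b q).2 (b r).2
      rw [hsplit] at this
      simp only [hb'] at this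
      simp only [Matrix.of_apply, mul_neg, neg_mul, neg_neg, Finset.sum_neg_distrib]
      rw [← eq_neg_iff_add_eq_zero.mpr this]
      by_cases hpq : p = q <;> by_cases hqr : q = r <;> simp [hpq, hqr, eq_comm])
    (by
      intro p
      have := (h _ (b p).2).1
      rw [hsplit] at this
      simp only [hb', Finset.sum_ite_eq', Finset.mem_univ, if_true] at this
      simp only [Matrix.of_apply, Finset.sum_neg_distrib]
      linear_combination -this)
  have hbr : ∀ k j, (b k : ι → K) (e (.inr j)) = if j = τ k then -1 else 0 := fun k j => by
    have := hτ j k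
    rw [Matrix.of_apply, neg_eq_iff_eq_neg] at this
    rw [this]
    split_ifs <;> simp
  let s : Equiv.Perm (Fin n ⊕ Fin n) := (Equiv.sumComm _ _).trans (Equiv.sumCongr τ.symm τ)
  let σ : Equiv.Perm ι := e.symm.trans (s.trans e)
  have hσl : ∀ k, σ (e (.inl k)) = e (.inr (τ k)) := fun k => by simp [σ, s]
  have hσr : ∀ k, σ (e (.inr k)) = e (.inl (τ.symm k)) := fun k => by simp [σ, s]
  have hind : ∀ P : ι → Prop, (∀ k, P (e (.inl k))) → (∀ k, P (e (.inr k))) → ∀ i, P i :=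
    fun P hl hr i => by
      rw [← e.apply_symm_apply i]
      rcases e.symm i with k | k
      exacts [hl k, hr k]
  refine ⟨σ, hind _ (fun k => ?_) fun k => ?_, hind _ (fun k => ?_) fun k => ?_, fun x => ?_⟩
  · simp [hσl]
  · simp [hσr]
  · simp [hσl, hσr]
  · simp [hσl, hσr]
  let y : W := ∑ k, x (e (.inl k)) • b k
  have hy : ∀ i, (y : ι → K) i = ∑ k, x (e (.inl k)) * (b k : ι → K) i := fun i => by
    simp [y, Finset.sum_apply]
  have hyl : ∀ k, (y : ι → K) (e (.inl k)) = x (e (.inl k)) := fun k => by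
    simp [hy, hb']
  have hyr : ∀ k, (y : ι → K) (e (.inr (τ k))) = -x (e (.inl k)) := fun k => by
    simp [hy, hbr]
  constructor
  · intro hx
    have hxy : (⟨x, hx⟩ : W) = y := hbij.1 (funext fun i => by
      simpa only [he] using (hyl i).symm)
    have hr : ∀ k, x (e (.inr (τ k))) = -x (e (.inl k)) := fun k => by
      rw [← hyr, ← hxy]
    refine hind _ (fun k => ?_) fun k => ?_
    · rw [hσl, hr, add_neg_cancel]
    · have := hr (τ.symm k)
      rw [τ.apply_symm_apply] at this
      rw [hσr, this, neg_add_cancel]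
  · intro hx
    have hxy : x = y := funext (hind _ (fun k => (hyl k).symm) fun k => by
      have h1 := hyr (τ.symm k)
      have h2 := hx (e (.inr k))
      rw [τ.apply_symm_apply] at h1
      rw [hσr] at h2
      rw [h1, eq_neg_iff_add_eq_zero, h2])
    exact hxy ▸ y.2

/-- The subspace of vectors that are antisymmetric under a permutation of the coordinates. -/
def antisymmetricSubspace {ι : Type*} (K : Type*) [Field K] (σ : Equiv.Perm ι) :
    Submodule K (ι → K) where
  carrier := {x | ∀ i, x i + x (σ i) = 0}
  add_mem' {x y} hx hy i := by
    simp only [Pi.add_apply]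
    linear_combination hx i + hy i
  zero_mem' i := by simp
  smul_mem' c x hx i := by
    simp only [Pi.smul_apply, smul_eq_mul]
    linear_combination c * hx i

theorem mem_antisymmetricSubspace {ι K : Type*} [Field K] {σ : Equiv.Perm ι} {x : ι → K} :
    x ∈ antisymmetricSubspace K σ ↔ ∀ i, x i + x (σ i) = 0 := Iff.rfl

/-- An antisymmetric vector for a fixed-point-free involution is determined freely by its
coordinates at the smaller elements of the orbits. -/
theorem finrank_antisymmetricSubspace {ι K : Type*} [Fintype ι] [LinearOrder ι] [Field K]
    (σ : Equiv.Perm ι) (h1 : ∀ i, σ i ≠ i) (h2 : ∀ i, σ (σ i) = i) :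
    Module.finrank K (antisymmetricSubspace K σ) =
      (Finset.univ.filter fun i => i < σ i).card := by
  let g : antisymmetricSubspace K σ →ₗ[K] ({i // i < σ i} → K) :=
    LinearMap.pi fun i => (LinearMap.proj i.1).comp (Submodule.subtype _)
  have hg : Function.Bijective g := by
    constructor
    · rw [← LinearMap.ker_eq_bot, LinearMap.ker_eq_bot']
      intro x hx
      have hlt : ∀ i, i < σ i → (x : ι → K) i = 0 := fun i hi => congrFun hx ⟨i, hi⟩
      ext i
      rcases lt_or_gt_of_ne (h1 i) with hi | hi
      · have := x.2 i
        rwa [hlt (σ i) (by rwa [h2]), add_zero] at this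
      · exact hlt i hi
    · intro z
      refine ⟨⟨fun i => if hi : i < σ i then z ⟨i, hi⟩ else
        if hi' : σ i < σ (σ i) then -z ⟨σ i, hi'⟩ else 0, fun i => ?_⟩, funext fun i => ?_⟩
      · rcases lt_or_gt_of_ne (h1 i) with hi | hi
        · simp [h2, hi, hi.not_gt]
        · simp [h2, hi, hi.not_gt]
      · exact dif_pos i.2
  rw [(LinearEquiv.ofBijective g hg).finrank_eq, Module.finrank_fintype_fun_eq_card,
    Fintype.card_subtype]

theorem power_sums_eq_zero_of_antisymmetric {ι K : Type*} [Fintype ι] [Field K] [CharZero K]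
    {σ : Equiv.Perm ι} {x : ι → K} (hx : ∀ i, x i + x (σ i) = 0) :
    ∑ i, x i = 0 ∧ ∑ i, x i ^ 3 = 0 := by
  have hx' : ∀ i, x (σ i) = -x i := fun i => by linear_combination hx i
  constructor
  · have := Equiv.sum_comp σ x
    simp only [hx', Finset.sum_neg_distrib] at this
    exact self_eq_neg.mp this.symm
  · have := Equiv.sum_comp σ fun i => x i ^ 3
    simp only [hx', Odd.neg_pow (by decide : Odd 3), Finset.sum_neg_distrib] at this
    exact self_eq_neg.mp this.symm

theorem antisymmetricSubspace_injOn {ι K : Type*} [Field K] [CharZero K] :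
    Set.InjOn (antisymmetricSubspace K : Equiv.Perm ι → _)
      {σ | (∀ i, σ i ≠ i) ∧ ∀ i, σ (σ i) = i} := by
  classical
  intro σ hσ τ _ hστ
  ext i
  have hmem : (Pi.single i 1 - Pi.single (σ i) 1 : ι → K) ∈ antisymmetricSubspace K σ := by
    intro j
    have h1 : σ j = i ↔ j = σ i := ⟨fun h => by rw [← h, hσ.2], fun h => by rw [h, hσ.2]⟩
    simp only [Pi.sub_apply, Pi.single_apply, h1, σ.injective.eq_iff]
    ring
  rw [hστ] at hmem
  have := hmem i
  by_contra hne
  simp only [Pi.sub_apply, Pi.single_apply, (hσ.1 i).symm, if_true, if_false, Ne.symm hne] at this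
  split_ifs at this <;> norm_num at this

theorem card_perfect_matchings_fin_six :
    (Finset.univ.filter fun σ : Equiv.Perm (Fin 6) =>
      (∀ i, σ i ≠ i) ∧ ∀ i, σ (σ i) = i).card = 15 := by
  decide +kernel

theorem card_lt_involution_fin_six : ∀ σ : Equiv.Perm (Fin 6), (∀ i, σ i ≠ i) →
    (∀ i, σ (σ i) = i) → (Finset.univ.filter fun i => i < σ i).card = 3 := by
  decide +kernel

/-- Every projective 2-plane contained in the Segre primal `X₀` is one of the
15 planes `ℙ(P_M)`: if `W ⊆ ℂ^6` is a 3-dimensional linear subspace with every `x ∈ W`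
satisfying `∑ xᵢ = 0` and `∑ xᵢ³ = 0`, then `W = P_M` for some perfect matching `M`
(a fixed-point-free involution `σ` of `Fin 6`, the pairs being `{i, σ i}`). In particular
`X₀` contains exactly 15 planes. -/
theorem stmt_8 :
    (∀ W : Submodule ℂ (Fin 6 → ℂ), Module.finrank ℂ W = 3 →
      (∀ x ∈ W, ∑ i, x i = 0 ∧ ∑ i, x i ^ 3 = 0) →
      ∃ σ : Equiv.Perm (Fin 6), (∀ i, σ i ≠ i) ∧ (∀ i, σ (σ i) = i) ∧
        ∀ x : Fin 6 → ℂ, x ∈ W ↔ ∀ i, x i + x (σ i) = 0) ∧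
    {W : Submodule ℂ (Fin 6 → ℂ) | Module.finrank ℂ W = 3 ∧
      ∀ x ∈ W, ∑ i, x i = 0 ∧ ∑ i, x i ^ 3 = 0}.ncard = 15 := by
  have hmain : ∀ W : Submodule ℂ (Fin 6 → ℂ), Module.finrank ℂ W = 3 →
      (∀ x ∈ W, ∑ i, x i = 0 ∧ ∑ i, x i ^ 3 = 0) →
      ∃ σ : Equiv.Perm (Fin 6), (∀ i, σ i ≠ i) ∧ (∀ i, σ (σ i) = i) ∧
        ∀ x : Fin 6 → ℂ, x ∈ W ↔ ∀ i, x i + x (σ i) = 0 := fun W hW h =>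
    exists_matching_of_power_sums_eq_zero (by simp) W hW h
  refine ⟨hmain, ?_⟩
  have himage : {W : Submodule ℂ (Fin 6 → ℂ) | Module.finrank ℂ W = 3 ∧
      ∀ x ∈ W, ∑ i, x i = 0 ∧ ∑ i, x i ^ 3 = 0} =
      antisymmetricSubspace ℂ '' {σ | (∀ i, σ i ≠ i) ∧ ∀ i, σ (σ i) = i} := by
    ext W
    constructor
    · rintro ⟨hW, h⟩
      obtain ⟨σ, h1, h2, h3⟩ := hmain W hW h
      exact ⟨σ, ⟨h1, h2⟩, Submodule.ext fun x => (h3 x).symm⟩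
    · rintro ⟨σ, ⟨h1, h2⟩, rfl⟩
      exact ⟨(finrank_antisymmetricSubspace σ h1 h2).trans (card_lt_involution_fin_six σ h1 h2),
        fun x hx => power_sums_eq_zero_of_antisymmetric hx⟩
  rw [himage, antisymmetricSubspace_injOn.ncard_image, ← card_perfect_matchings_fin_six,
    ← Set.ncard_coe_finset]
  simp
end

section
/- Let p = (1,1,1,−1,−1,−1) ∈ ℂ^6, a singular point of the Segre primal X_0. For every x ∈ ℂ^6 not proportional to p, the projective line through [p] and [x] is contained in X_0 (i.e. Σ_i (s p_i + t x_i) = 0 and Σ_i (s p_i + t x_i)^3 = 0 for all s, t ∈ ℂ) if and only if x ∈ P_M for one of the six perfect matchings M of {0,…,5} each of whose pairs contains exactly one element of {0,1,2}. Hence the union of the lines of X_0 through the double point [p] coincides with the union of the six planes of X_0 passing through [p]. -/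
/-- The inclusion `{0,1,2} ↪ {0,…,5}`. -/
def emb3 : Fin 3 → Fin 6 := fun i => ⟨i.1, by have := i.isLt; omega⟩

/-- The bijection `{0,1,2} ≃ {3,4,5}`, `i ↦ i + 3`. -/
def shift3 : Fin 3 → Fin 6 := fun i => ⟨i.1 + 3, by have := i.isLt; omega⟩

/-- The double point `p = (1,1,1,-1,-1,-1)` of the Segre primal. -/
def pSeg : Fin 6 → ℂ := fun i => if (i : ℕ) < 3 then 1 else -1

/-- Two pairs with equal sums and equal sums of squares agree up to order. -/
theorem pair_eq_or_swap_of_power_sums {K : Type*} [Field K] [CharZero K] {a b c d : K}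
    (h1 : a + b = c + d) (h2 : a ^ 2 + b ^ 2 = c ^ 2 + d ^ 2) :
    (a = c ∧ b = d) ∨ (a = d ∧ b = c) := by
  have h : (2 : K) * ((a - c) * (a - d)) = 0 := by
    linear_combination h2 + (a - b - c - d) * h1
  rcases mul_eq_zero.mp ((mul_eq_zero.mp h).resolve_left two_ne_zero) with h | h
  · exact Or.inl ⟨by linear_combination h, by linear_combination h1 - h⟩
  · exact Or.inr ⟨by linear_combination h, by linear_combination h1 - h⟩

/-- Two triples with equal first three power sums agree up to a permutation. -/
theorem exists_perm_of_power_sums {K : Type*} [Field K] [CharZero K] (a b : Fin 3 → K)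
    (h1 : ∑ i, a i = ∑ i, b i) (h2 : ∑ i, a i ^ 2 = ∑ i, b i ^ 2)
    (h3 : ∑ i, a i ^ 3 = ∑ i, b i ^ 3) :
    ∃ σ : Equiv.Perm (Fin 3), ∀ i, a i = b (σ i) := by
  suffices ∃ i j k : Fin 3, (i ≠ j ∧ i ≠ k ∧ j ≠ k) ∧ a 0 = b i ∧ a 1 = b j ∧ a 2 = b k by
    obtain ⟨i, j, k, ⟨hij, hik, hjk⟩, h0, h1, h2⟩ := this
    have hinj : Function.Injective ![i, j, k] := by
      intro m n hmn
      fin_cases m <;> fin_cases n <;> simp_all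
    refine ⟨Equiv.ofBijective _ (Finite.injective_iff_bijective.mp hinj), fun m => ?_⟩
    fin_cases m <;> simpa
  simp only [Fin.sum_univ_three] at h1 h2 h3
  have h : (6 : K) * ((a 0 - b 0) * ((a 0 - b 1) * (a 0 - b 2))) = 0 := by
    have e2 : 2 * (a 0 * a 1 + a 0 * a 2 + a 1 * a 2) =
        2 * (b 0 * b 1 + b 0 * b 2 + b 1 * b 2) := by
      linear_combination (a 0 + a 1 + a 2 + (b 0 + b 1 + b 2)) * h1 - h2
    have e3 : 6 * (a 0 * a 1 * a 2) = 6 * (b 0 * b 1 * b 2) := by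
      linear_combination 2 * h3 - 2 * (a 0 ^ 2 + a 1 ^ 2 + a 2 ^ 2) * h1
        - 2 * (b 0 + b 1 + b 2) * h2
        + (a 0 + a 1 + a 2) * e2 + 2 * (b 0 * b 1 + b 0 * b 2 + b 1 * b 2) * h1
    linear_combination 6 * a 0 ^ 2 * h1 - 3 * a 0 * e2 + e3
  rcases mul_eq_zero.mp ((mul_eq_zero.mp h).resolve_left (by norm_num)) with h | h
  · have h0 : a 0 = b 0 := sub_eq_zero.mp h
    rcases pair_eq_or_swap_of_power_sums (a := a 1) (b := a 2) (c := b 1) (d := b 2)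
      (by linear_combination h1 - h0)
      (by linear_combination h2 - (a 0 + b 0) * h0) with h | h
    · exact ⟨0, 1, 2, by decide, h0, h⟩
    · exact ⟨0, 2, 1, by decide, h0, h⟩
  rcases mul_eq_zero.mp h with h | h
  · have h0 : a 0 = b 1 := sub_eq_zero.mp h
    rcases pair_eq_or_swap_of_power_sums (a := a 1) (b := a 2) (c := b 0) (d := b 2)
      (by linear_combination h1 - h0)
      (by linear_combination h2 - (a 0 + b 1) * h0) with h | h
    · exact ⟨1, 0, 2, by decide, h0, h⟩
    · exact ⟨1, 2, 0, by decide, h0, h⟩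
  · have h0 : a 0 = b 2 := sub_eq_zero.mp h
    rcases pair_eq_or_swap_of_power_sums (a := a 1) (b := a 2) (c := b 0) (d := b 1)
      (by linear_combination h1 - h0)
      (by linear_combination h2 - (a 0 + b 2) * h0) with h | h
    · exact ⟨2, 0, 1, by decide, h0, h⟩
    · exact ⟨2, 1, 0, by decide, h0, h⟩

theorem sum_fin_six_eq_emb3_add_shift3 (f : Fin 6 → ℂ) :
    ∑ i, f i = ∑ i, f (emb3 i) + ∑ i, f (shift3 i) := by
  simp only [Fin.sum_univ_six, Fin.sum_univ_three, add_assoc]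
  rfl

theorem pSeg_emb3 (i : Fin 3) : pSeg (emb3 i) = 1 := by
  simp [pSeg, emb3]

theorem pSeg_shift3 (i : Fin 3) : pSeg (shift3 i) = -1 := by
  simp [pSeg, shift3]

/-- Let `p = (1,1,1,-1,-1,-1)`, a singular point of the Segre primal `X₀`.
For every `x ∈ ℂ^6` not proportional to `p`, the projective line through `[p]` and `[x]` is
contained in `X₀` iff `x ∈ P_M` for one of the six perfect matchings `M` each of whose pairs
contains exactly one element of `{0,1,2}` (such matchings are encoded by bijections
`β : {0,1,2} → {3,4,5}`, here a permutation of `Fin 3`, the pairs being `{i, β i + 3}`).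
Hence the union of the lines of `X₀` through `[p]` is the union of the six planes of `X₀`
through `[p]`. -/
theorem stmt_9 (x : Fin 6 → ℂ) (hx : ∀ c : ℂ, x ≠ c • pSeg) :
    (∀ s t : ℂ, ∑ i, (s * pSeg i + t * x i) = 0 ∧ ∑ i, (s * pSeg i + t * x i) ^ 3 = 0) ↔
      ∃ β : Equiv.Perm (Fin 3), ∀ i : Fin 3, x (emb3 i) + x (shift3 (β i)) = 0 := by
  constructor
  · intro h
    obtain ⟨σ, hσ⟩ := exists_perm_of_power_sums (fun i => x (emb3 i)) (fun i => -x (shift3 i))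
      (by
        have := (h 0 1).1
        simp only [sum_fin_six_eq_emb3_add_shift3, Fin.sum_univ_three] at this ⊢
        linear_combination this)
      (by
        have hp := (h 1 1).2
        have hm := (h (-1) 1).2
        simp only [sum_fin_six_eq_emb3_add_shift3, pSeg_emb3, pSeg_shift3,
          Fin.sum_univ_three] at hp hm ⊢
        linear_combination (hp - hm) / 6)
      (by
        have := (h 0 1).2
        simp only [sum_fin_six_eq_emb3_add_shift3, Fin.sum_univ_three] at this ⊢
        linear_combination this)
    exact ⟨σ, fun i => by linear_combination hσ i⟩
  · rintro ⟨β, hβ⟩ s t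
    have hneg (i : Fin 3) : x (emb3 i) = -x (shift3 (β i)) := eq_neg_of_add_eq_zero_left (hβ i)
    rw [sum_fin_six_eq_emb3_add_shift3, sum_fin_six_eq_emb3_add_shift3]
    simp only [pSeg_emb3, pSeg_shift3, hneg]
    rw [Equiv.sum_comp β (fun i => s * 1 + t * -x (shift3 i)),
      Equiv.sum_comp β (fun i => (s * 1 + t * -x (shift3 i)) ^ 3),
      ← Finset.sum_add_distrib, ← Finset.sum_add_distrib]
    exact ⟨Finset.sum_eq_zero fun i _ => by ring, Finset.sum_eq_zero fun i _ => by ring⟩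
end

section
/- For every v ∈ ℂ^6 with v_0 + v_1 + ⋯ + v_5 = 0, the two conditions v_0^2 + v_1^2 + v_2^2 = v_3^2 + v_4^2 + v_5^2 and v_0^3 + v_1^3 + ⋯ + v_5^3 = 0 hold simultaneously if and only if there is a bijection β : {0,1,2} → {3,4,5} such that v_i + v_{β(i)} = 0 for all i ∈ {0,1,2}. (Thus the cone of lines of the Segre primal through the double point [1,1,1,−1,−1,−1], a complete intersection of type (2,3) in the hyperplane {Σ v_i = 0}, equals the union of the six planes of X_0 through that point.) -/
/-- Two pairs whose sums are opposite and whose sums of squares agree are opposite as multisets. -/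
theorem pair_opposite {b c e f : ℂ} (h1 : b + c + e + f = 0)
    (h2 : b ^ 2 + c ^ 2 = e ^ 2 + f ^ 2) :
    (b + e = 0 ∧ c + f = 0) ∨ (b + f = 0 ∧ c + e = 0) := by
  have hc : c = -(b + e + f) := by linear_combination h1
  subst hc
  have h : (b + e) * (b + f) = 0 := by linear_combination h2 / 2
  rcases mul_eq_zero.mp h with h | h
  · exact Or.inl ⟨h, by linear_combination -h⟩
  · exact Or.inr ⟨h, by linear_combination -h⟩

/-- If the first three power sums of `a, b, c` and of `-d, -e, -f` agree, then `a` is one of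
`-d, -e, -f`. -/
theorem prod_add_eq_zero {a b c d e f : ℂ} (h1 : a + b + c + d + e + f = 0)
    (h2 : a ^ 2 + b ^ 2 + c ^ 2 = d ^ 2 + e ^ 2 + f ^ 2)
    (h3 : a ^ 3 + b ^ 3 + c ^ 3 + d ^ 3 + e ^ 3 + f ^ 3 = 0) :
    (a + d) * (a + e) * (a + f) = 0 := by
  have e1 : d + e + f = -(a + b + c) := by linear_combination h1
  have e2 : d * e + d * f + e * f = a * b + a * c + b * c := by
    linear_combination (d + e + f - (a + b + c)) / 2 * e1 + h2 / 2
  have e3 : d * e * f = -(a * b * c) := by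
    linear_combination h3 / 3 - (d ^ 2 + e ^ 2 + f ^ 2 - (d * e + d * f + e * f)) / 3 * e1
      - (a + b + c) / 3 * (h2 + e2)
  linear_combination a ^ 2 * e1 + a * e2 + e3

/-- The sum over `{3,4,5}` of a function of the coordinates, when these are the opposites of the
coordinates indexed by `{0,1,2}`. -/
theorem sum_shift3_eq {v : Fin 6 → ℂ} {β : Equiv.Perm (Fin 3)}
    (hβ : ∀ i : Fin 3, v (emb3 i) + v (shift3 (β i)) = 0) (g : ℂ → ℂ) :
    g (v 3) + g (v 4) + g (v 5) = g (-v 0) + g (-v 1) + g (-v 2) := by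
  have h := Equiv.sum_comp β (fun i => g (v (shift3 i)))
  simp only [fun i => eq_neg_of_add_eq_zero_right (hβ i), Fin.sum_univ_three] at h
  exact h.symm

/-- For every `v ∈ ℂ^6` with `v 0 + ⋯ + v 5 = 0`, the two conditions
`v 0² + v 1² + v 2² = v 3² + v 4² + v 5²` and `v 0³ + ⋯ + v 5³ = 0` hold simultaneously iff
there is a bijection `β : {0,1,2} → {3,4,5}` (encoded as a permutation of `Fin 3`, with
`β(i) = (shift3 ∘ β) i`) such that `vᵢ + v_{β(i)} = 0` for all `i ∈ {0,1,2}`. Thus the cone of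
lines of the Segre primal through the double point `[1,1,1,-1,-1,-1]`, a complete intersection
of type `(2,3)` in the hyperplane `{∑ vᵢ = 0}`, equals the union of the six planes of `X₀`
through that point. -/
theorem stmt_10 (v : Fin 6 → ℂ) (hsum : ∑ i, v i = 0) :
    (v 0 ^ 2 + v 1 ^ 2 + v 2 ^ 2 = v 3 ^ 2 + v 4 ^ 2 + v 5 ^ 2 ∧ ∑ i, v i ^ 3 = 0) ↔
      ∃ β : Equiv.Perm (Fin 3), ∀ i : Fin 3, v (emb3 i) + v (shift3 (β i)) = 0 := by
  simp only [Fin.sum_univ_six] at hsum ⊢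
  constructor
  · rintro ⟨h2, h3⟩
    have key : ∀ β : Equiv.Perm (Fin 3), v 0 + v (shift3 (β 0)) = 0 →
        v 1 + v (shift3 (β 1)) = 0 → v 2 + v (shift3 (β 2)) = 0 →
        ∃ β : Equiv.Perm (Fin 3), ∀ i : Fin 3, v (emb3 i) + v (shift3 (β i)) = 0 :=
      fun β p q r => ⟨β, Fin.forall_fin_succ.mpr ⟨p, Fin.forall_fin_two.mpr ⟨q, r⟩⟩⟩
    rcases mul_eq_zero.mp (prod_add_eq_zero hsum h2 h3) with h | h
    · rcases mul_eq_zero.mp h with h | h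
      · rcases pair_opposite (b := v 1) (c := v 2) (e := v 4) (f := v 5)
          (by linear_combination hsum - h)
          (by linear_combination h2 - (v 0 - v 3) * h) with ⟨p, q⟩ | ⟨p, q⟩
        · exact key 1 h p q
        · exact key (Equiv.swap 1 2) h p q
      · rcases pair_opposite (b := v 1) (c := v 2) (e := v 3) (f := v 5)
          (by linear_combination hsum - h)
          (by linear_combination h2 - (v 0 - v 4) * h) with ⟨p, q⟩ | ⟨p, q⟩
        · exact key (Equiv.swap 0 1) h p q
        · exact key (finRotate 3) h p q
    · rcases pair_opposite (b := v 1) (c := v 2) (e := v 3) (f := v 4)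
        (by linear_combination hsum - h)
        (by linear_combination h2 - (v 0 - v 5) * h) with ⟨p, q⟩ | ⟨p, q⟩
      · exact key (finRotate 3).symm h p q
      · exact key (Equiv.swap 0 2) h p q
  · rintro ⟨β, hβ⟩
    constructor
    · linear_combination -sum_shift3_eq hβ (· ^ 2)
    · linear_combination sum_shift3_eq hβ (· ^ 3)
end

section
/- Let p ∈ ℂ^6 be nonzero with Σ p_i = 0 and Σ p_i^3 = 0, such that [p] is a smooth point of the Segre primal X_0 (not all p_i^2 are equal) and [p] does not lie on any of the 15 planes ℙ(P_M). Let W = {v ∈ ℂ^6 : Σ v_i = 0 and Σ p_i^2 v_i = 0} (the affine cone over the tangent hyperplane of X_0 at [p]). Then the quadratic form v ↦ Σ_i p_i v_i^2 restricted to the 4-dimensional subspace W has radical exactly the line spanned by p; in particular it has rank 3 (so the quadric cone of lines having intersection multiplicity at least 3 with X_0 at [p] is a rank 3 quadric cone with vertex [p]). -/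
open Finset in
/-- For six numbers with vanishing first and third power sums, vanishing of the fifth elementary
symmetric function implies vanishing of the fifth power sum. -/
lemma sum_pow_five_eq_zero (p : Fin 6 → ℂ) (h1 : ∑ i, p i = 0) (h3 : ∑ i, p i ^ 3 = 0)
    (h : ∑ i, ∏ j ∈ univ.erase i, p j = 0) : ∑ i, p i ^ 5 = 0 := by
  have e (i : Fin 6) : ∏ j ∈ univ.erase i, p j = ∏ j, if j = i then 1 else p j := by
    rw [← mul_prod_erase univ _ (mem_univ i), if_pos rfl, one_mul]
    exact prod_congr rfl fun j hj => (if_neg (ne_of_mem_erase hj)).symm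
  simp only [e] at h
  simp [Fin.sum_univ_six, Fin.prod_univ_six, Fin.ext_iff] at h h1 h3 ⊢
  generalize p 0 = a, p 1 = b, p 2 = c, p 3 = d, p 4 = x, p 5 = y at *
  linear_combination 5 * h + (5 / 6) * (a ^ 2 + b ^ 2 + c ^ 2 + d ^ 2 + x ^ 2 + y ^ 2) * h3
    - (1 / 24) * ((a + b + c + d + x + y) ^ 4
      - 10 * (a + b + c + d + x + y) ^ 2 * (a ^ 2 + b ^ 2 + c ^ 2 + d ^ 2 + x ^ 2 + y ^ 2)
      + 20 * (a + b + c + d + x + y) * (a ^ 3 + b ^ 3 + c ^ 3 + d ^ 3 + x ^ 3 + y ^ 3)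
      + 15 * (a ^ 2 + b ^ 2 + c ^ 2 + d ^ 2 + x ^ 2 + y ^ 2) ^ 2
      - 30 * (a ^ 4 + b ^ 4 + c ^ 4 + d ^ 4 + x ^ 4 + y ^ 4)) * h1

/-- If the first, third and fifth power sums vanish, some entry is opposite to the first one. -/
lemma exists_add_eq_zero_of_six (a b c d x y : ℂ) (h1 : a + b + c + d + x + y = 0)
    (h3 : a ^ 3 + b ^ 3 + c ^ 3 + d ^ 3 + x ^ 3 + y ^ 3 = 0)
    (h5 : a ^ 5 + b ^ 5 + c ^ 5 + d ^ 5 + x ^ 5 + y ^ 5 = 0) :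
    a + b = 0 ∨ a + c = 0 ∨ a + d = 0 ∨ a + x = 0 ∨ a + y = 0 := by
  have : (a + b) * ((a + c) * ((a + d) * ((a + x) * (a + y)))) = 0 := by
    obtain rfl : y = -(a + b + c + d + x) := by linear_combination h1
    linear_combination (1 / 5) * h5 +
      (a ^ 2 / 3 - (1 / 6) * (a ^ 2 + b ^ 2 + c ^ 2 + d ^ 2 + x ^ 2 +
        (a + b + c + d + x) ^ 2)) * h3
  simpa [mul_eq_zero] using this

/-- If the first and third power sums vanish, some entry is opposite to the first one. -/
lemma exists_add_eq_zero_of_four (a b c d : ℂ) (h1 : a + b + c + d = 0)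
    (h3 : a ^ 3 + b ^ 3 + c ^ 3 + d ^ 3 = 0) : a + b = 0 ∨ a + c = 0 ∨ a + d = 0 := by
  have : (a + b) * ((a + c) * (a + d)) = 0 := by
    obtain rfl : d = -(a + b + c) := by linear_combination h1
    linear_combination (1 / 3) * h3
  simpa [mul_eq_zero] using this

/-- Six numbers whose first, third and fifth power sums vanish can be matched into opposite
pairs. -/
lemma exists_perm_add_eq_zero (p : Fin 6 → ℂ) (h1 : ∑ i, p i = 0) (h3 : ∑ i, p i ^ 3 = 0)
    (h5 : ∑ i, p i ^ 5 = 0) :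
    ∃ τ : Equiv.Perm (Fin 6), p (τ 0) + p (τ 1) = 0 ∧ p (τ 2) + p (τ 3) = 0 ∧
      p (τ 4) + p (τ 5) = 0 := by
  obtain ⟨τ, hτ⟩ : ∃ τ : Equiv.Perm (Fin 6), p (τ 0) + p (τ 1) = 0 := by
    obtain ⟨j, hj, h⟩ : ∃ j, j ≠ 0 ∧ p 0 + p j = 0 := by
      simp only [Fin.sum_univ_six] at h1 h3 h5
      rcases exists_add_eq_zero_of_six _ _ _ _ _ _ h1 h3 h5 with h | h | h | h | h
      exacts [⟨1, by decide, h⟩, ⟨2, by decide, h⟩, ⟨3, by decide, h⟩, ⟨4, by decide, h⟩,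
        ⟨5, by decide, h⟩]
    refine ⟨Equiv.swap 1 j, ?_⟩
    rwa [Equiv.swap_apply_of_ne_of_ne (by decide) hj.symm, Equiv.swap_apply_left]
  rw [← Equiv.sum_comp τ] at h1 h3
  simp only [Fin.sum_univ_six] at h1 h3
  have g1 : p (τ 2) + p (τ 3) + p (τ 4) + p (τ 5) = 0 := by linear_combination h1 - hτ
  have g3 : p (τ 2) ^ 3 + p (τ 3) ^ 3 + p (τ 4) ^ 3 + p (τ 5) ^ 3 = 0 := by
    linear_combination h3 -
      (p (τ 0) ^ 2 - p (τ 0) * p (τ 1) + p (τ 1) ^ 2) * hτ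
  rcases exists_add_eq_zero_of_four _ _ _ _ g1 g3 with h | h | h
  · exact ⟨τ, hτ, h, by linear_combination g1 - h⟩
  · refine ⟨Equiv.swap 3 4 |>.trans τ, hτ, h, ?_⟩
    change p (τ 3) + p (τ 5) = 0
    linear_combination g1 - h
  · refine ⟨Equiv.swap 3 5 |>.trans τ, hτ, h, ?_⟩
    change p (τ 4) + p (τ 3) = 0
    linear_combination g1 - h

/-- A point of the Segre primal off its fifteen planes has nonzero fifth elementary symmetric
function. -/
lemma sum_prod_erase_ne_zero (p : Fin 6 → ℂ) (h1 : ∑ i, p i = 0) (h3 : ∑ i, p i ^ 3 = 0)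
    (hpl : ∀ σ : Equiv.Perm (Fin 6), (∀ i, σ i ≠ i) → (∀ i, σ (σ i) = i) →
      ¬ ∀ i, p i + p (σ i) = 0) :
    ∑ i, ∏ j ∈ Finset.univ.erase i, p j ≠ 0 := by
  intro h
  obtain ⟨τ, h01, h23, h45⟩ :=
    exists_perm_add_eq_zero p h1 h3 (sum_pow_five_eq_zero p h1 h3 h)
  let s : Equiv.Perm (Fin 6) := Equiv.swap 0 1 * Equiv.swap 2 3 * Equiv.swap 4 5
  refine hpl ((τ.symm.trans s).trans τ) (τ.surjective.forall.2 fun i => ?_)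
    (τ.surjective.forall.2 fun i => ?_) (τ.surjective.forall.2 fun i => ?_)
  · have : ∀ i, s i ≠ i := by decide
    simpa using this i
  · have : ∀ i, s (s i) = i := by decide
    simpa using this i
  · simp only [Equiv.trans_apply, Equiv.symm_apply_apply]
    fin_cases i
    exacts [h01, (add_comm _ _).trans h01, h23, (add_comm _ _).trans h23, h45,
      (add_comm _ _).trans h45]

open Finset in
/-- If `p i * u i` is constant and `u` has zero sum, then `u = 0` as soon as the penultimate
elementary symmetric function of `p` is nonzero. -/
lemma eq_zero_of_mul_eq_const {ι K : Type*} [Fintype ι] [DecidableEq ι] [Field K]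
    {p u : ι → K} {a : K} (he : ∑ i, ∏ j ∈ univ.erase i, p j ≠ 0) (hu : ∑ i, u i = 0)
    (h : ∀ i, p i * u i = a) : u = 0 := by
  have ha : a = 0 := by
    refine (mul_eq_zero.1 ?_).resolve_right he
    calc a * ∑ i, ∏ j ∈ univ.erase i, p j = ∑ i, (∏ j, p j) * u i := by
          rw [mul_sum]
          refine sum_congr rfl fun i _ => ?_
          rw [← mul_prod_erase univ p (mem_univ i), ← h i]
          ring
      _ = 0 := by rw [← mul_sum, hu, mul_zero]
  subst ha
  have hne {i k : ι} (hik : k ≠ i) : u k * ∏ j ∈ univ.erase i, p j = 0 := by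
    rw [← mul_prod_erase _ p (mem_erase.2 ⟨hik, mem_univ k⟩), ← mul_assoc, mul_comm (u k), h,
      zero_mul]
  have hself (i : ι) : u i * ∏ j ∈ univ.erase i, p j = 0 := by
    rw [← sum_eq_single_of_mem (f := fun k => u k * ∏ j ∈ univ.erase i, p j) i (mem_univ i)
      fun k _ hk => hne hk, ← sum_mul, hu, zero_mul]
  funext i
  refine (mul_eq_zero.1 ?_).resolve_right he
  rw [mul_sum]
  refine sum_eq_zero fun k _ => ?_
  rcases eq_or_ne i k with rfl | hik
  exacts [hself i, hne hik]

/-- The linear functional `w ↦ ∑ i, c i * w i`. -/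
noncomputable def weightedSum {ι K : Type*} [Fintype ι] [Field K] (c : ι → K) :
    (ι → K) →ₗ[K] K :=
  ∑ i, c i • LinearMap.proj i

@[simp]
lemma weightedSum_apply {ι K : Type*} [Fintype ι] [Field K] (c w : ι → K) :
    weightedSum c w = ∑ i, c i * w i := by
  simp [weightedSum]

/-- A functional vanishing wherever `∑ w i` and `∑ c i * w i` vanish is a combination of these
two. -/
lemma exists_eq_add_mul_of_forall {ι K : Type*} [Fintype ι] [Field K] (c d : ι → K)
    (h : ∀ w : ι → K, ∑ i, w i = 0 → ∑ i, c i * w i = 0 → ∑ i, d i * w i = 0) :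
    ∃ a b : K, ∀ i, d i = a + b * c i := by
  classical
  have key : weightedSum d ∈
      Submodule.span K (Set.range ![weightedSum (fun _ : ι => (1 : K)), weightedSum c]) := by
    refine mem_span_of_iInf_ker_le_ker fun w hw => ?_
    simp only [Submodule.mem_iInf, Fin.forall_fin_two, LinearMap.mem_ker] at hw
    simpa using h w (by simpa using hw.1) (by simpa using hw.2)
  rw [Matrix.range_cons, Matrix.range_cons, Matrix.range_empty, Set.union_empty,
    Set.singleton_union, Submodule.mem_span_pair] at key
  obtain ⟨a, b, hab⟩ := key
  refine ⟨a, b, fun i => ?_⟩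
  simpa [Pi.single_apply] using (LinearMap.congr_fun hab (Pi.single i 1)).symm

/-- The common kernel of `∑ v i` and `∑ c i * v i` has codimension two when `c` is not
constant. -/
lemma finrank_add_two_of_mem_iff {ι K : Type*} [Fintype ι] [Field K] (c : ι → K)
    (hc : ¬ ∀ i j, c i = c j) (W : Submodule K (ι → K))
    (hW : ∀ v, v ∈ W ↔ (∑ i, v i = 0 ∧ ∑ i, c i * v i = 0)) :
    Module.finrank K W + 2 = Fintype.card ι := by
  classical
  let f : (ι → K) →ₗ[K] K × K := (weightedSum fun _ => 1).prod (weightedSum c)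
  have hker : W = LinearMap.ker f := by
    ext v
    simp [f, hW]
  push Not at hc
  obtain ⟨i, j, hij⟩ := hc
  have hsub : c i - c j ≠ 0 := sub_ne_zero.2 hij
  have hf : Function.Surjective f := by
    rintro ⟨s, t⟩
    refine ⟨Pi.single i ((t - c j * s) / (c i - c j)) +
      Pi.single j ((c i * s - t) / (c i - c j)), ?_⟩
    apply Prod.ext
    all_goals
      simp [f, mul_add, Finset.sum_add_distrib, Pi.single_apply]
      field_simp
      ring
  have := f.finrank_range_add_finrank_ker
  rw [LinearMap.range_eq_top.2 hf, finrank_top, ← hker] at this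
  simp only [Module.finrank_prod, Module.finrank_self, Module.finrank_fintype_fun_eq_card] at this
  omega


/-- Let `p ∈ ℂ^6` be nonzero with `∑ pᵢ = 0`, `∑ pᵢ³ = 0`, such that `[p]`
is a smooth point of the Segre primal (not all `pᵢ²` equal) lying on none of the 15 planes
`ℙ(P_M)` (matchings encoded as fixed-point-free involutions, pairs `{i, σ i}`). Let
`W = {v : ∑ vᵢ = 0 and ∑ pᵢ² vᵢ = 0}`, the affine cone over the tangent hyperplane of `X₀`
at `[p]`. Then `W` is 4-dimensional, and the radical of the quadratic form `v ↦ ∑ pᵢ vᵢ²`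
restricted to `W` — the set of `v ∈ W` whose polar pairing with every `w ∈ W` vanishes — is
exactly the line spanned by `p`; in particular this form has rank `4 - 1 = 3`. -/
theorem stmt_13 (p : Fin 6 → ℂ) (hp : p ≠ 0)
    (h1 : ∑ i, p i = 0) (h3 : ∑ i, p i ^ 3 = 0)
    (hsm : ¬ ∀ i j, p i ^ 2 = p j ^ 2)
    (hpl : ∀ σ : Equiv.Perm (Fin 6), (∀ i, σ i ≠ i) → (∀ i, σ (σ i) = i) →
      ¬ ∀ i, p i + p (σ i) = 0)
    (W : Submodule ℂ (Fin 6 → ℂ))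
    (hW : ∀ v, v ∈ W ↔ (∑ i, v i = 0 ∧ ∑ i, p i ^ 2 * v i = 0)) :
    Module.finrank ℂ W = 4 ∧
    {v : Fin 6 → ℂ | v ∈ W ∧ ∀ w ∈ W,
        (∑ i, p i * (v i + w i) ^ 2) - (∑ i, p i * v i ^ 2) - (∑ i, p i * w i ^ 2) = 0}
      = (Submodule.span ℂ {p} : Submodule ℂ (Fin 6 → ℂ)) := by
  have hpolar (v w : Fin 6 → ℂ) : (∑ i, p i * (v i + w i) ^ 2) - (∑ i, p i * v i ^ 2)
      - (∑ i, p i * w i ^ 2) = 2 * ∑ i, p i * v i * w i := by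
    rw [← Finset.sum_sub_distrib, ← Finset.sum_sub_distrib, Finset.mul_sum]
    exact Finset.sum_congr rfl fun i _ => by ring
  refine ⟨by simpa using finrank_add_two_of_mem_iff (fun i => p i ^ 2) hsm W hW, ?_⟩
  ext v
  simp only [Set.mem_ofPred_eq, SetLike.mem_coe, Submodule.mem_span_singleton, hpolar, hW,
    mul_eq_zero, OfNat.ofNat_ne_zero, false_or]
  constructor
  · rintro ⟨⟨hv, -⟩, hrad⟩
    obtain ⟨a, b, hab⟩ := exists_eq_add_mul_of_forall (fun i => p i ^ 2) (fun i => p i * v i)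
      fun w hw hw' => hrad w ⟨hw, hw'⟩
    refine ⟨b, (sub_eq_zero.1 ?_).symm⟩
    refine eq_zero_of_mul_eq_const (a := a) (sum_prod_erase_ne_zero p h1 h3 hpl) ?_ fun i => ?_
    · simp [← Finset.mul_sum, hv, h1]
    · simp only [Pi.sub_apply, Pi.smul_apply, smul_eq_mul]
      linear_combination hab i
  · rintro ⟨b, rfl⟩
    refine ⟨⟨?_, ?_⟩, fun w hw => ?_⟩
    · simp [← Finset.mul_sum, h1]
    · calc ∑ i, p i ^ 2 * (b • p) i = b * ∑ i, p i ^ 3 := by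
            rw [Finset.mul_sum]
            exact Finset.sum_congr rfl fun i _ => by simp; ring
        _ = 0 := by rw [h3, mul_zero]
    · calc ∑ i, p i * (b • p) i * w i = b * ∑ i, p i ^ 2 * w i := by
            rw [Finset.mul_sum]
            exact Finset.sum_congr rfl fun i _ => by simp; ring
        _ = 0 := by rw [hw.2, mul_zero]
end

section
/- Let p ∈ ℂ^6 be nonzero with Σ p_i = 0 and Σ p_i^3 = 0, such that [p] is a smooth point of the Segre primal X_0 (not all p_i^2 are equal) and [p] does not lie on any of the 15 planes ℙ(P_M). Then the set of projective lines through [p] contained in X_0 — i.e. the set of 2-dimensional linear subspaces L ⊆ ℂ^6 with p ∈ L and every x ∈ L satisfying Σ x_i = 0 and Σ x_i^3 = 0 — has exactly 6 elements; moreover, every such L is contained in {v : Σ p_i^2 v_i = 0} and every v ∈ L satisfies Σ p_i v_i^2 = 0 (the six lines lie on the rank 3 quadric cone with vertex [p] of lines having intersection multiplicity at least 3 with X_0 at [p]). -/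
/-- A vector of the affine cone over the Segre primal lying on none of the fifteen planes. -/
structure IsGeneral (p : Fin 6 → ℂ) : Prop where
  sum_eq_zero : ∑ i, p i = 0
  sum_cube_eq_zero : ∑ i, p i ^ 3 = 0
  add_ne_zero : ∀ i j, i ≠ j → p i + p j ≠ 0

/-- The line joining `[p]` and `[x]` has contact of order at least three with the Segre primal
at `[p]`. -/
structure HasContact (p x : Fin 6 → ℂ) : Prop where
  tangent : ∑ i, p i ^ 2 * x i = 0
  polar : ∑ i, p i * x i ^ 2 = 0

/-- The vector `x` lies in the plane of the matching `01|23|45`. -/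
structure IsPaired (x : Fin 6 → ℂ) : Prop where
  zero_one : x 0 + x 1 = 0
  two_three : x 2 + x 3 = 0
  four_five : x 4 + x 5 = 0

lemma IsGeneral.comp {p : Fin 6 → ℂ} (hp : IsGeneral p) (e : Equiv.Perm (Fin 6)) :
    IsGeneral (p ∘ e) where
  sum_eq_zero := (Equiv.sum_comp e p).trans hp.sum_eq_zero
  sum_cube_eq_zero := (Equiv.sum_comp e fun i => p i ^ 3).trans hp.sum_cube_eq_zero
  add_ne_zero _ _ hij := hp.add_ne_zero _ _ (e.injective.ne hij)

lemma hasContact_comp_iff {p x : Fin 6 → ℂ} (e : Equiv.Perm (Fin 6)) :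
    HasContact (p ∘ e) (x ∘ e) ↔ HasContact p x := by
  have h2 := Equiv.sum_comp e fun i => p i ^ 2 * x i
  have h1 := Equiv.sum_comp e fun i => p i * x i ^ 2
  exact ⟨fun h => ⟨h2.symm.trans h.tangent, h1.symm.trans h.polar⟩,
    fun h => ⟨h2.trans h.tangent, h1.trans h.polar⟩⟩

/-- If a sum of six numbers and the sum of their cubes vanish, and two of the numbers are
opposite, then so are two of the remaining ones. -/
lemma mul_add_add_eq_zero {a b c d e f : ℂ} (h1 : a + b + c + d + e + f = 0)
    (h3 : a ^ 3 + b ^ 3 + c ^ 3 + d ^ 3 + e ^ 3 + f ^ 3 = 0) (hab : a + b = 0) :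
    (d + e) * (e + f) * (d + f) = 0 := by
  obtain rfl : b = -a := by linear_combination hab
  obtain rfl : c = -(d + e + f) := by linear_combination h1
  linear_combination -h3 / 3

/-- A vector of the affine cone over the Segre primal with `x 0 + x 1 = 0` lies in one of the
three planes whose matching contains `{0, 1}`. -/
lemma exists_isPaired_of_add_eq_zero {x : Fin 6 → ℂ} (h1 : ∑ i, x i = 0)
    (h3 : ∑ i, x i ^ 3 = 0) (h01 : x 0 + x 1 = 0) :
    IsPaired x ∨ IsPaired (x ∘ Equiv.swap 3 4) ∨ IsPaired (x ∘ Equiv.swap 3 5) := by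
  simp only [Fin.sum_univ_six] at h1 h3
  rcases mul_eq_zero.1 (mul_add_add_eq_zero h1 h3 h01) with h | h
  · rcases mul_eq_zero.1 h with h | h
    · exact .inr (.inr ⟨h01, show x 2 + x 5 = 0 by linear_combination h1 - h01 - h,
        show x 4 + x 3 = 0 by linear_combination h⟩)
    · exact .inl ⟨h01, by linear_combination h1 - h01 - h, h⟩
  · exact .inr (.inl ⟨h01, show x 2 + x 4 = 0 by linear_combination h1 - h01 - h, h⟩)

lemma isGeneral_of_notMem_planes {p : Fin 6 → ℂ} (h1 : ∑ i, p i = 0) (h3 : ∑ i, p i ^ 3 = 0)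
    (hpl : ∀ σ : Equiv.Perm (Fin 6), (∀ i, σ i ≠ i) → (∀ i, σ (σ i) = i) →
      ¬ ∀ i, p i + p (σ i) = 0) : IsGeneral p := by
  have key : ∀ e : Equiv.Perm (Fin 6), ¬ IsPaired (p ∘ e) := by
    intro e he
    let τ : Equiv.Perm (Fin 6) := Equiv.swap 0 1 * Equiv.swap 2 3 * Equiv.swap 4 5
    have hτ : ∀ i, τ i ≠ i := by decide
    have hττ : ∀ i, τ (τ i) = i := by decide
    have hsum : ∀ i, p (e i) + p (e (τ i)) = 0 := by
      have h01 : p (e 0) + p (e 1) = 0 := he.zero_one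
      have h23 : p (e 2) + p (e 3) = 0 := he.two_three
      have h45 : p (e 4) + p (e 5) = 0 := he.four_five
      intro i
      fin_cases i
      exacts [h01, (add_comm _ _).trans h01, h23, (add_comm _ _).trans h23, h45,
        (add_comm _ _).trans h45]
    refine hpl (e * τ * e⁻¹) (fun i h => hτ (e⁻¹ i) ?_) (fun i => ?_) (fun i => ?_)
    · simpa [Equiv.Perm.mul_apply] using congrArg (e⁻¹ : Equiv.Perm (Fin 6)) h
    · simp [Equiv.Perm.mul_apply, hττ]
    · simpa [Equiv.Perm.mul_apply] using hsum (e⁻¹ i)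
  refine ⟨h1, h3, fun i j hij h => ?_⟩
  have he : ∀ i j : Fin 6, i ≠ j →
      (Equiv.swap 0 i * Equiv.swap 1 (Equiv.swap 0 i j)) 0 = i ∧
        (Equiv.swap 0 i * Equiv.swap 1 (Equiv.swap 0 i j)) 1 = j := by decide
  obtain ⟨hi, hj⟩ := he i j hij
  set e := Equiv.swap 0 i * Equiv.swap 1 (Equiv.swap 0 i j)
  rcases exists_isPaired_of_add_eq_zero (x := p ∘ e)
    ((Equiv.sum_comp e p).trans h1) ((Equiv.sum_comp e fun i => p i ^ 3).trans h3)
    (by simpa [hi, hj] using h) with h | h | h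
  · exact key e h
  · exact key (e * Equiv.swap 3 4) (by rwa [Equiv.Perm.coe_mul, ← Function.comp_assoc])
  · exact key (e * Equiv.swap 3 5) (by rwa [Equiv.Perm.coe_mul, ← Function.comp_assoc])

/-- The tangent hyperplane at `[p]` contains no node. -/
lemma IsGeneral.sum_sq_ne {p : Fin 6 → ℂ} (hp : IsGeneral p) :
    p 0 ^ 2 + p 2 ^ 2 + p 4 ^ 2 ≠ p 1 ^ 2 + p 3 ^ 2 + p 5 ^ 2 := by
  intro h2
  have h1 := hp.sum_eq_zero
  have h3 := hp.sum_cube_eq_zero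
  simp only [Fin.sum_univ_six] at h1 h3
  have : (p 0 + p 1) * (p 0 + p 3) * (p 0 + p 5) = 0 := by
    linear_combination h3 / 3 + (p 0 / 2 - (p 0 + p 2 + p 4) / 2) * h2 +
      (p 0 ^ 2 + (p 1 + p 3 + p 5 - (p 0 + p 2 + p 4)) / 2 * p 0 +
        ((p 1 + p 3 + p 5) ^ 2 - (p 1 + p 3 + p 5) * (p 0 + p 2 + p 4) +
          (p 0 + p 2 + p 4) ^ 2) / 6 - (p 1 ^ 2 + p 3 ^ 2 + p 5 ^ 2) / 2) * h1
  have h01 := hp.add_ne_zero 0 1 (by decide)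
  have h03 := hp.add_ne_zero 0 3 (by decide)
  have h05 := hp.add_ne_zero 0 5 (by decide)
  exact mul_ne_zero (mul_ne_zero h01 h03) h05 this

/-- A line through `[p]` of contact order at least three does not meet the intersection of two
planes whose matchings share one pair. -/
lemma IsGeneral.eq_zero_of_isPaired {p x : Fin 6 → ℂ} (hp : IsGeneral p) (hx : HasContact p x)
    (hx₁ : IsPaired x) (h24 : x 2 + x 4 = 0) : x = 0 := by
  have h1 := hp.sum_eq_zero
  have ht := hx.tangent
  have hq := hx.polar
  simp only [Fin.sum_univ_six] at h1 ht hq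
  have e1 : x 1 = -x 0 := by linear_combination hx₁.zero_one
  have e3 : x 3 = -x 2 := by linear_combination hx₁.two_three
  have e4 : x 4 = -x 2 := by linear_combination h24
  have e5 : x 5 = x 2 := by linear_combination hx₁.four_five - h24
  rw [e1, e3, e4, e5] at ht hq
  have hsq : (p 0 + p 1) * ((x 0 - x 2) * (x 0 + x 2)) = 0 := by
    linear_combination hq - x 2 ^ 2 * h1
  have h02 : x 0 = 0 ∧ x 2 = 0 := by
    rcases mul_eq_zero.1 ((mul_eq_zero.1 hsq).resolve_left
      (hp.add_ne_zero 0 1 (by decide))) with h | h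
    · have hn : p 0 ^ 2 + p 2 ^ 2 + p 5 ^ 2 ≠ p 1 ^ 2 + p 3 ^ 2 + p 4 ^ 2 :=
        (hp.comp (Equiv.swap 4 5)).sum_sq_ne
      have h2 : x 2 = 0 := (mul_eq_zero.1 (show x 2 * _ = 0 by
        linear_combination ht - (p 0 ^ 2 - p 1 ^ 2) * h)).resolve_right (sub_ne_zero.2 hn)
      exact ⟨by linear_combination h + h2, h2⟩
    · have hn : p 0 ^ 2 + p 3 ^ 2 + p 4 ^ 2 ≠ p 1 ^ 2 + p 2 ^ 2 + p 5 ^ 2 :=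
        (hp.comp (Equiv.swap 2 3)).sum_sq_ne
      have h2 : x 2 = 0 := (mul_eq_zero.1 (show x 2 * _ = 0 by
        linear_combination (p 0 ^ 2 - p 1 ^ 2) * h - ht)).resolve_right (sub_ne_zero.2 hn)
      exact ⟨by linear_combination h - h2, h2⟩
  funext i
  fin_cases i <;> simp [e1, e3, e4, e5, h02.1, h02.2]

/-- If `A + B + C = 0` and `(d, e, f)` has norm `-ABC` for the quadratic form `diag(A, B, C)`, then
the orthogonal complement of `(d, e, f)` contains exactly two isotropic lines, provided `(d, e, f)`
is not orthogonal to `(1, 1, 1)`. -/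
lemma exists_two_isotropic {A B C d e f : ℂ} (hsum : A + B + C = 0) (hk : A * B * C ≠ 0)
    (hd : A * d ^ 2 + B * e ^ 2 + C * f ^ 2 = -(A * B * C))
    (hs : A * d + B * e + C * f ≠ 0) :
    ∃ x y z : Bool → ℂ,
      (∀ b, ¬ (x b = 0 ∧ y b = 0 ∧ z b = 0) ∧ A * d * x b + B * e * y b + C * f * z b = 0 ∧
        A * x b ^ 2 + B * y b ^ 2 + C * z b ^ 2 = 0) ∧
      (∀ c, ¬ (x true = c * x false ∧ y true = c * y false ∧ z true = c * z false)) ∧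
      ∀ x' y' z', A * d * x' + B * e * y' + C * f * z' = 0 →
        A * x' ^ 2 + B * y' ^ 2 + C * z' ^ 2 = 0 →
        ∃ b c, x' = c * x b ∧ y' = c * y b ∧ z' = c * z b := by
  set k := A * B * C with hkdef
  set s := A * d + B * e + C * f with hsdef
  let ε : Bool → ℂ := fun b => if b then 1 else -1
  have hε : ∀ b, ε b ^ 2 = 1 := by simp [ε]
  let x : Bool → ℂ := fun b => k + s * d + ε b * (B * C * (e - f))
  let y : Bool → ℂ := fun b => k + s * e + ε b * (A * C * (f - d))
  let z : Bool → ℂ := fun b => k + s * f + ε b * (A * B * (d - e))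
  have hiso : ∀ b, A * x b ^ 2 + B * y b ^ 2 + C * z b ^ 2 = 0 := by
    intro b
    simp only [x, y, z]
    linear_combination s ^ 2 * hd + (k ^ 2 + k * (A * d ^ 2 + B * e ^ 2 + C * f ^ 2)) * hsum +
      k * (B * C * (e - f) ^ 2 + A * C * (f - d) ^ 2 + A * B * (d - e) ^ 2) * hε b
  have hpair : A * x true * x false + B * y true * y false + C * z true * z false =
      2 * k * s ^ 2 := by
    simp only [x, y, z, ε]
    norm_num
    linear_combination s ^ 2 * hd + (k ^ 2 - k * (A * d ^ 2 + B * e ^ 2 + C * f ^ 2)) * hsum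
  have hne : 2 * k * s ^ 2 ≠ 0 := mul_ne_zero (mul_ne_zero two_ne_zero hk) (pow_ne_zero 2 hs)
  refine ⟨x, y, z, fun b => ⟨?_, ?_, hiso b⟩, ?_, ?_⟩
  · rintro ⟨hx, hy, hz⟩
    apply hne
    rw [← hpair]
    cases b <;> simp [hx, hy, hz]
  · simp only [x, y, z]
    linear_combination s * hd
  · rintro c ⟨hx, hy, hz⟩
    apply hne
    rw [← hpair, hx, hy, hz]
    linear_combination c * hiso false
  · intro x' y' z' ht hq
    let m := A * x' + B * y' + C * z'
    let n := x' * (e - f) + y' * (f - d) + z' * (d - e)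
    have hx : s ^ 2 * x' = m * (k + s * d) - n * (B * C * (e - f)) := by
      linear_combination (B * (e - d) + C * (f - d)) * ht - m * hd +
        x' * (A * d ^ 2 + B * e ^ 2 + C * f ^ 2) * hsum
    have hy : s ^ 2 * y' = m * (k + s * e) - n * (A * C * (f - d)) := by
      linear_combination (C * (f - e) + A * (d - e)) * ht - m * hd +
        y' * (A * d ^ 2 + B * e ^ 2 + C * f ^ 2) * hsum
    have hz : s ^ 2 * z' = m * (k + s * f) - n * (A * B * (d - e)) := by
      linear_combination (A * (d - f) + B * (e - f)) * ht - m * hd +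
        z' * (A * d ^ 2 + B * e ^ 2 + C * f ^ 2) * hsum
    have hmn : k * s ^ 2 * ((m - n) * (m + n)) = 0 := by
      generalize m = m, n = n at hx hy hz
      linear_combination s ^ 4 * hq -
        A * (s ^ 2 * x' + (m * (k + s * d) - n * (B * C * (e - f)))) * hx -
        B * (s ^ 2 * y' + (m * (k + s * e) - n * (A * C * (f - d)))) * hy -
        C * (s ^ 2 * z' + (m * (k + s * f) - n * (A * B * (d - e)))) * hz -
        m ^ 2 * s ^ 2 * hd -
        (m ^ 2 * k ^ 2 + n ^ 2 * k * (A * d ^ 2 + B * e ^ 2 + C * f ^ 2)) * hsum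
    have hs2 : s ^ 2 ≠ 0 := pow_ne_zero 2 hs
    rcases mul_eq_zero.1 ((mul_eq_zero.1 hmn).resolve_left (mul_ne_zero hk hs2)) with h | h
    · refine ⟨false, m / s ^ 2, ?_, ?_, ?_⟩ <;> rw [div_mul_eq_mul_div, eq_div_iff hs2] <;>
        simp only [x, y, z, ε, Bool.false_eq_true, if_false]
      · linear_combination hx + h * (B * C * (e - f))
      · linear_combination hy + h * (A * C * (f - d))
      · linear_combination hz + h * (A * B * (d - e))
    · refine ⟨true, m / s ^ 2, ?_, ?_, ?_⟩ <;> rw [div_mul_eq_mul_div, eq_div_iff hs2] <;>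
        simp only [x, y, z, ε, if_true]
      · linear_combination hx - h * (B * C * (e - f))
      · linear_combination hy - h * (A * C * (f - d))
      · linear_combination hz - h * (A * B * (d - e))

/-- Each plane containing `{0, 1}` in its matching contains exactly two directions of contact
order at least three at a general vector. -/
lemma IsGeneral.exists_two_isPaired {p : Fin 6 → ℂ} (hp : IsGeneral p) :
    ∃ u : Bool → Fin 6 → ℂ, (∀ b, u b ≠ 0 ∧ IsPaired (u b) ∧ HasContact p (u b)) ∧
      (∀ c : ℂ, u true ≠ c • u false) ∧
      ∀ x, IsPaired x → HasContact p x → ∃ b, ∃ c : ℂ, x = c • u b := by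
  have h1 := hp.sum_eq_zero
  have h3 := hp.sum_cube_eq_zero
  simp only [Fin.sum_univ_six] at h1 h3
  obtain ⟨x, y, z, hu, hne, hall⟩ := exists_two_isotropic
    (A := p 0 + p 1) (B := p 2 + p 3) (C := p 4 + p 5)
    (d := p 0 - p 1) (e := p 2 - p 3) (f := p 4 - p 5) (by linear_combination h1)
    (mul_ne_zero (mul_ne_zero (hp.add_ne_zero 0 1 (by decide)) (hp.add_ne_zero 2 3 (by decide)))
      (hp.add_ne_zero 4 5 (by decide)))
    (by
      linear_combination 4 / 3 * h3 - ((p 0 + p 1) ^ 2 + (p 2 + p 3) ^ 2 + (p 4 + p 5) ^ 2 -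
        (p 0 + p 1) * (p 2 + p 3) - (p 2 + p 3) * (p 4 + p 5) -
        (p 4 + p 5) * (p 0 + p 1)) / 3 * h1)
    (fun h => hp.sum_sq_ne (by linear_combination h))
  refine ⟨fun b => ![x b, -x b, y b, -y b, z b, -z b], fun b => ⟨fun h => (hu b).1 ?_, ?_, ?_⟩,
    fun c h => hne c ?_, fun v hv hc => ?_⟩
  · exact ⟨congrFun h 0, congrFun h 2, congrFun h 4⟩
  · exact ⟨add_neg_cancel (x b), add_neg_cancel (y b), add_neg_cancel (z b)⟩
  · constructor <;> rw [Fin.sum_univ_six]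
    · change p 0 ^ 2 * x b + p 1 ^ 2 * -x b + p 2 ^ 2 * y b + p 3 ^ 2 * -y b + p 4 ^ 2 * z b +
        p 5 ^ 2 * -z b = 0
      linear_combination (hu b).2.1
    · change p 0 * x b ^ 2 + p 1 * (-x b) ^ 2 + p 2 * y b ^ 2 + p 3 * (-y b) ^ 2 +
        p 4 * z b ^ 2 + p 5 * (-z b) ^ 2 = 0
      linear_combination (hu b).2.2
  · exact ⟨congrFun h 0, congrFun h 2, congrFun h 4⟩
  · have e1 : v 1 = -v 0 := by linear_combination hv.zero_one
    have e3 : v 3 = -v 2 := by linear_combination hv.two_three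
    have e5 : v 5 = -v 4 := by linear_combination hv.four_five
    have ht := hc.tangent
    have hq := hc.polar
    simp only [Fin.sum_univ_six] at ht hq
    rw [e1, e3, e5] at ht hq
    obtain ⟨b, c, hx, hy, hz⟩ := hall (v 0) (v 2) (v 4) (by linear_combination ht)
      (by linear_combination hq)
    refine ⟨b, c, funext fun i => ?_⟩
    fin_cases i <;> simp [e1, e3, e5, hx, hy, hz]

/-- Involutions carrying `01|23|45` to the three matchings containing `{0, 1}`. -/
def matchingPerm : Fin 3 → Equiv.Perm (Fin 6) :=
  ![1, Equiv.swap 3 4, Equiv.swap 3 5]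

lemma matchingPerm_comp_self (i : Fin 3) : matchingPerm i ∘ matchingPerm i = id := by
  fin_cases i <;> decide

lemma comp_matchingPerm_comp (x : Fin 6 → ℂ) (i : Fin 3) :
    (x ∘ matchingPerm i) ∘ matchingPerm i = x := by
  rw [Function.comp_assoc, matchingPerm_comp_self, Function.comp_id]

lemma matchingPerm_zero (i : Fin 3) : matchingPerm i 0 = 0 := by
  fin_cases i <;> decide

lemma matchingPerm_one (i : Fin 3) : matchingPerm i 1 = 1 := by
  fin_cases i <;> decide

lemma IsPaired.smul {x : Fin 6 → ℂ} (hx : IsPaired x) (c : ℂ) : IsPaired (c • x) where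
  zero_one := by simp [← mul_add, hx.zero_one]
  two_three := by simp [← mul_add, hx.two_three]
  four_five := by simp [← mul_add, hx.four_five]

lemma IsPaired.sum_eq_zero {x : Fin 6 → ℂ} (hx : IsPaired x) : ∑ i, x i = 0 := by
  rw [Fin.sum_univ_six]
  linear_combination hx.zero_one + hx.two_three + hx.four_five

lemma IsPaired.sum_cube_eq_zero {x : Fin 6 → ℂ} (hx : IsPaired x) : ∑ i, x i ^ 3 = 0 := by
  rw [Fin.sum_univ_six]
  linear_combination (x 0 ^ 2 - x 0 * x 1 + x 1 ^ 2) * hx.zero_one +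
    (x 2 ^ 2 - x 2 * x 3 + x 3 ^ 2) * hx.two_three + (x 4 ^ 2 - x 4 * x 5 + x 5 ^ 2) * hx.four_five

lemma comp_perm_eq_zero {x : Fin 6 → ℂ} {e : Equiv.Perm (Fin 6)} (h : x ∘ e = 0) : x = 0 :=
  funext fun i => by simpa using congrFun h (e.symm i)

lemma IsGeneral.eq_zero_of_lt {p x : Fin 6 → ℂ} (hp : IsGeneral p) (hx : HasContact p x)
    {i j : Fin 3} (hij : i < j) (hi : IsPaired (x ∘ matchingPerm i))
    (hj : IsPaired (x ∘ matchingPerm j)) : x = 0 := by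
  have h : (i = 0 ∧ j = 1) ∨ (i = 0 ∧ j = 2) ∨ (i = 1 ∧ j = 2) := by omega
  rcases h with ⟨rfl, rfl⟩ | ⟨rfl, rfl⟩ | ⟨rfl, rfl⟩
  · exact hp.eq_zero_of_isPaired hx hi hj.two_three
  · exact comp_perm_eq_zero ((hp.comp (Equiv.swap 4 5)).eq_zero_of_isPaired
      ((hasContact_comp_iff _).2 hx)
      ⟨hi.zero_one, hi.two_three, (add_comm _ _).trans hi.four_five⟩ hj.two_three)
  · exact comp_perm_eq_zero ((hp.comp (Equiv.swap 3 4 * Equiv.swap 4 5)).eq_zero_of_isPaired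
      ((hasContact_comp_iff _).2 hx)
      ⟨hi.zero_one, hi.two_three, (add_comm _ _).trans hi.four_five⟩ hj.two_three)

/-- A direction, normalised to satisfy `x 0 + x 1 = 0`, of a line through `[p]` contained in the
Segre primal. -/
structure IsDirection (p x : Fin 6 → ℂ) : Prop where
  add_eq_zero : x 0 + x 1 = 0
  sum_eq_zero : ∑ i, x i = 0
  sum_cube_eq_zero : ∑ i, x i ^ 3 = 0
  hasContact : HasContact p x

lemma IsGeneral.exists_six_directions {p : Fin 6 → ℂ} (hp : IsGeneral p) :
    ∃ v : Fin 3 × Bool → Fin 6 → ℂ, (∀ k, v k ≠ 0 ∧ IsDirection p (v k)) ∧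
      (∀ k l, ∀ c : ℂ, v k = c • v l → k = l) ∧
      ∀ x, IsDirection p x → ∃ k, ∃ c : ℂ, x = c • v k := by
  choose u hu hne hall using fun i => (hp.comp (matchingPerm i)).exists_two_isPaired
  have hcontact : ∀ i b, HasContact p (u i b ∘ matchingPerm i) := fun i b => by
    rw [← hasContact_comp_iff (matchingPerm i), comp_matchingPerm_comp]
    exact (hu i b).2.2
  refine ⟨fun k => u k.1 k.2 ∘ matchingPerm k.1, ?_, ?_, ?_⟩
  · rintro ⟨i, b⟩
    have hpair := (hu i b).2.1
    refine ⟨fun h => (hu i b).1 (comp_perm_eq_zero h), ?_, ?_, ?_, hcontact i b⟩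
    · simpa [matchingPerm_zero, matchingPerm_one] using hpair.zero_one
    · exact (Equiv.sum_comp _ (u i b)).trans hpair.sum_eq_zero
    · exact (Equiv.sum_comp _ fun j => u i b j ^ 3).trans hpair.sum_cube_eq_zero
  · rintro ⟨i, b⟩ ⟨j, b'⟩ c h
    dsimp only at h
    have hi : IsPaired ((u i b ∘ matchingPerm i) ∘ matchingPerm i) := by
      rw [comp_matchingPerm_comp]
      exact (hu i b).2.1
    have hj : IsPaired ((u i b ∘ matchingPerm i) ∘ matchingPerm j) := by
      rw [h, Pi.smul_comp, comp_matchingPerm_comp]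
      exact (hu j b').2.1.smul c
    have hzero : u i b ∘ matchingPerm i ≠ 0 := fun h => (hu i b).1 (comp_perm_eq_zero h)
    obtain rfl : i = j := by
      rcases lt_trichotomy i j with hlt | heq | hlt
      · exact absurd (hp.eq_zero_of_lt (hcontact i b) hlt hi hj) hzero
      · exact heq
      · exact absurd (hp.eq_zero_of_lt (hcontact i b) hlt hj hi) hzero
    have h' : u i b = c • u i b' := by
      have := congrArg (· ∘ matchingPerm i) h
      simpa only [Pi.smul_comp, comp_matchingPerm_comp] using this
    have hc : c ≠ 0 := by
      rintro rfl
      exact (hu i b).1 (by simpa using h')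
    cases b <;> cases b'
    · rfl
    · exact absurd (by rw [h', smul_smul, inv_mul_cancel₀ hc, one_smul]) (hne i c⁻¹)
    · exact absurd h' (hne i c)
    · rfl
  · intro x hx
    have key : ∃ i, IsPaired (x ∘ matchingPerm i) := by
      rcases exists_isPaired_of_add_eq_zero hx.sum_eq_zero hx.sum_cube_eq_zero hx.add_eq_zero
        with h | h | h
      exacts [⟨0, h⟩, ⟨1, h⟩, ⟨2, h⟩]
    obtain ⟨i, hi⟩ := key
    obtain ⟨b, c, h⟩ := hall i _ hi ((hasContact_comp_iff _).2 hx.hasContact)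
    refine ⟨(i, b), c, ?_⟩
    dsimp only
    rw [← Pi.smul_comp, ← h, comp_matchingPerm_comp]

lemma sum_add_smul_cube (p v : Fin 6 → ℂ) (a b : ℂ) :
    ∑ i, (a • p + b • v) i ^ 3 = a ^ 3 * ∑ i, p i ^ 3 + 3 * a ^ 2 * b * ∑ i, p i ^ 2 * v i +
      3 * a * b ^ 2 * ∑ i, p i * v i ^ 2 + b ^ 3 * ∑ i, v i ^ 3 := by
  simp only [Fin.sum_univ_six, Pi.add_apply, Pi.smul_apply, smul_eq_mul]
  ring

/-- Lines through `[p]` contained in the Segre primal have contact of order at least three. -/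
lemma hasContact_of_mem {p v : Fin 6 → ℂ} {L : Submodule ℂ (Fin 6 → ℂ)} (hpL : p ∈ L)
    (hL : ∀ x ∈ L, ∑ i, x i = 0 ∧ ∑ i, x i ^ 3 = 0) (hv : v ∈ L) : HasContact p v := by
  have h : ∀ b : ℂ, ∑ i, ((1 : ℂ) • p + b • v) i ^ 3 = 0 := fun b =>
    (hL _ (L.add_mem (L.smul_mem 1 hpL) (L.smul_mem b hv))).2
  have hadd := h 1
  have hsub := h (-1)
  have h3p := (hL p hpL).2
  have h3v := (hL v hv).2
  rw [sum_add_smul_cube, h3p, h3v] at hadd hsub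
  exact ⟨by linear_combination (hadd - hsub) / 6, by linear_combination (hadd + hsub) / 6⟩

lemma finrank_span_pair_eq_two {p x : Fin 6 → ℂ} (hp : p 0 + p 1 ≠ 0) (hx : x ≠ 0)
    (h01 : x 0 + x 1 = 0) : Module.finrank ℂ (Submodule.span ℂ {p, x}) = 2 := by
  have hli : LinearIndependent ℂ ![p, x] := by
    refine LinearIndependent.pair_iff.2 fun s t hst => ?_
    have h0 : s * p 0 + t * x 0 = 0 := congrFun hst 0
    have h1 : s * p 1 + t * x 1 = 0 := congrFun hst 1
    have hs : s = 0 := (mul_eq_zero.1 (show s * (p 0 + p 1) = 0 by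
      linear_combination h0 + h1 - t * h01)).resolve_right hp
    subst hs
    exact ⟨rfl, (smul_eq_zero.1 (by simpa using hst)).resolve_right hx⟩
  rw [← Matrix.range_cons_cons_empty p x ![], finrank_span_eq_card hli, Fintype.card_fin]

lemma exists_mem_ne_zero_add_eq_zero {p : Fin 6 → ℂ} (hp : p 0 + p 1 ≠ 0)
    {L : Submodule ℂ (Fin 6 → ℂ)} (hdim : Module.finrank ℂ L = 2) (hpL : p ∈ L) :
    ∃ x ∈ L, x ≠ 0 ∧ x 0 + x 1 = 0 := by
  obtain ⟨w, hwL, hw⟩ : ∃ w ∈ L, w ∉ Submodule.span ℂ {p} := by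
    by_contra! h
    have := (Submodule.finrank_mono (show L ≤ Submodule.span ℂ {p} from h)).trans
      (finrank_span_le_card ({p} : Set (Fin 6 → ℂ)))
    simp [hdim] at this
  refine ⟨w - ((w 0 + w 1) / (p 0 + p 1)) • p, L.sub_mem hwL (L.smul_mem _ hpL),
    fun h => hw ?_, ?_⟩
  · exact Submodule.mem_span_singleton.2 ⟨_, (sub_eq_zero.1 h).symm⟩
  · simp only [Pi.sub_apply, Pi.smul_apply, smul_eq_mul]
    field_simp
    ring

/-- Let `p ∈ ℂ^6` be nonzero with `∑ pᵢ = 0`, `∑ pᵢ³ = 0`, such that `[p]`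
is a smooth point of the Segre primal `X₀` (not all `pᵢ²` equal) lying on none of the 15 planes
`ℙ(P_M)` (matchings encoded as fixed-point-free involutions, pairs `{i, σ i}`). Then the set of
projective lines through `[p]` contained in `X₀` — i.e. of 2-dimensional subspaces `L ⊆ ℂ^6`
with `p ∈ L` contained in the affine cone of `X₀` — has exactly 6 elements; moreover every such
`L` lies in the tangent hyperplane `{v : ∑ pᵢ² vᵢ = 0}` and on the quadric cone
`{v : ∑ pᵢ vᵢ² = 0}` of lines with contact of order ≥ 3 at `[p]`. -/
theorem stmt_14 (p : Fin 6 → ℂ) (hp : p ≠ 0)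
    (h1 : ∑ i, p i = 0) (h3 : ∑ i, p i ^ 3 = 0)
    (hsm : ¬ ∀ i j, p i ^ 2 = p j ^ 2)
    (hpl : ∀ σ : Equiv.Perm (Fin 6), (∀ i, σ i ≠ i) → (∀ i, σ (σ i) = i) →
      ¬ ∀ i, p i + p (σ i) = 0) :
    {L : Submodule ℂ (Fin 6 → ℂ) | Module.finrank ℂ L = 2 ∧ p ∈ L ∧
        ∀ x ∈ L, ∑ i, x i = 0 ∧ ∑ i, x i ^ 3 = 0}.ncard = 6 ∧
    ∀ L : Submodule ℂ (Fin 6 → ℂ), Module.finrank ℂ L = 2 → p ∈ L →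
      (∀ x ∈ L, ∑ i, x i = 0 ∧ ∑ i, x i ^ 3 = 0) →
      ∀ v ∈ L, (∑ i, p i ^ 2 * v i = 0 ∧ ∑ i, p i * v i ^ 2 = 0) := by
  have hg := isGeneral_of_notMem_planes h1 h3 hpl
  have h01 := hg.add_ne_zero 0 1 (by decide)
  refine ⟨?_, fun L _ hpL hL v hv =>
    ⟨(hasContact_of_mem hpL hL hv).tangent, (hasContact_of_mem hpL hL hv).polar⟩⟩
  obtain ⟨v, hv, hinj, hall⟩ := hg.exists_six_directions
  have hset : {L : Submodule ℂ (Fin 6 → ℂ) | Module.finrank ℂ L = 2 ∧ p ∈ L ∧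
      ∀ x ∈ L, ∑ i, x i = 0 ∧ ∑ i, x i ^ 3 = 0} =
      Set.range fun k => Submodule.span ℂ {p, v k} := by
    ext L
    constructor
    · rintro ⟨hdim, hpL, hL⟩
      obtain ⟨x, hxL, hx, hx01⟩ := exists_mem_ne_zero_add_eq_zero h01 hdim hpL
      obtain ⟨k, c, rfl⟩ := hall x ⟨hx01, (hL x hxL).1, (hL x hxL).2, hasContact_of_mem hpL hL hxL⟩
      have hc : c ≠ 0 := fun h => hx (by rw [h, zero_smul])
      have hvL : v k ∈ L := (L.smul_mem_iff hc).1 hxL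
      refine ⟨k, Submodule.eq_of_le_of_finrank_eq ?_ ?_⟩
      · exact Submodule.span_le.2 (Set.insert_subset hpL (Set.singleton_subset_iff.2 hvL))
      · rw [hdim, finrank_span_pair_eq_two h01 (hv k).1 (hv k).2.add_eq_zero]
    · rintro ⟨k, rfl⟩
      have hk := (hv k).2
      refine ⟨finrank_span_pair_eq_two h01 (hv k).1 hk.add_eq_zero,
        Submodule.subset_span (Set.mem_insert _ _), fun x hx => ?_⟩
      obtain ⟨a, b, rfl⟩ := Submodule.mem_span_pair.1 hx
      constructor
      · simp [Finset.sum_add_distrib, ← Finset.mul_sum, h1, hk.sum_eq_zero]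
      · rw [sum_add_smul_cube, h3, hk.hasContact.tangent, hk.hasContact.polar,
          hk.sum_cube_eq_zero]
        ring
  have hinjective : Function.Injective fun k => Submodule.span ℂ {p, v k} := by
    intro k l hkl
    dsimp only at hkl
    have hmem : v k ∈ Submodule.span ℂ {p, v l} := by
      rw [← hkl]
      exact Submodule.subset_span (by simp)
    obtain ⟨a, b, hab⟩ := Submodule.mem_span_pair.1 hmem
    have e0 : a * p 0 + b * v l 0 = v k 0 := congrFun hab 0
    have e1 : a * p 1 + b * v l 1 = v k 1 := congrFun hab 1
    have ha : a = 0 := (mul_eq_zero.1 (show a * (p 0 + p 1) = 0 by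
      linear_combination e0 + e1 - b * (hv l).2.add_eq_zero + (hv k).2.add_eq_zero)).resolve_right
        h01
    exact hinj k l b (by rw [← hab, ha, zero_smul, zero_add])
  rw [hset, ← Nat.card_coe_set_eq, Nat.card_range_of_injective hinjective]
  simp
end

section
/- Let M be a perfect matching of {0,…,5} and let p ∈ P_M be nonzero such that [p] is not a singular point of the Segre primal X_0 and [p] lies on no plane ℙ(P_{M'}) with M' ≠ M. Then: (a) every projective line through [p] contained in the plane ℙ(P_M) is contained in X_0; and (b) the set of 2-dimensional linear subspaces L ⊆ ℂ^6 with p ∈ L, L ⊆ C(X_0), and L ⊄ P_M has exactly 2 elements. That is, the set of lines of X_0 through [p] consists of the pencil of lines through [p] in the plane ℙ(P_M) plus two more distinct lines not lying on that plane. -/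
/-- If `p i + p j = 0` for some `j ∉ {i, σ i}`, then conjugating `σ` by a transposition gives
another matching whose plane contains `p`. -/
theorem exists_other_matching {α : Type*} [DecidableEq α] (σ : Equiv.Perm α)
    (hfix : ∀ i, σ i ≠ i) (hinv : ∀ i, σ (σ i) = i) (p : α → ℂ)
    (hpM : ∀ i, p i + p (σ i) = 0) {i j : α} (hij : j ≠ i) (hj : j ≠ σ i)
    (h : p i + p j = 0) :
    ∃ σ' : Equiv.Perm α, (∀ i, σ' i ≠ i) ∧ (∀ i, σ' (σ' i) = i) ∧ σ' ≠ σ ∧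
      ∀ i, p i + p (σ' i) = 0 := by
  set s := Equiv.swap (σ i) j with hs
  have hss : ∀ x, s (s x) = x := fun x => Equiv.swap_apply_self _ _ x
  have hps : ∀ x, p (s x) = p x := by
    intro x
    have := hpM i
    have hpe : p (σ i) = p j := by linear_combination this - h
    rw [hs, Equiv.swap_apply_def]
    split_ifs with h1 h2
    · rw [h1, hpe]
    · rw [h2, hpe]
    · rfl
  refine ⟨s * σ * s, fun x hx => ?_, fun x => ?_, fun hx => ?_, fun x => ?_⟩
  · apply hfix (s x)
    have := congrArg s hx
    simpa [hss] using this
  · simp [hss, hinv]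
  · have h1 : s i = i := Equiv.swap_apply_of_ne_of_ne (hfix i).symm hij.symm
    have h2 : (s * σ * s) i = j := by
      rw [Equiv.Perm.mul_apply, Equiv.Perm.mul_apply, h1, hs, Equiv.swap_apply_left]
    exact hj (by rw [← h2, hx])
  · have := hpM (s x)
    rw [hps] at this
    simpa [hps] using this

/-- A fixed-point-free involution of `Fin 6` is conjugate to `(0 1)(2 3)(4 5)`. -/
theorem exists_adapted_equiv (σ : Equiv.Perm (Fin 6)) (hfix : ∀ i, σ i ≠ i)
    (hinv : ∀ i, σ (σ i) = i) :
    ∃ e : Fin 6 ≃ Fin 6, σ (e 0) = e 1 ∧ σ (e 2) = e 3 ∧ σ (e 4) = e 5 := by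
  obtain ⟨j, hj⟩ : ∃ j, j ∉ ({0, σ 0} : Finset (Fin 6)) := by
    by_contra! h
    have := Finset.card_le_card (fun x _ => h x : (Finset.univ : Finset (Fin 6)) ⊆ _)
    have h2 := Finset.card_le_two (a := 0) (b := σ 0)
    simp only [Finset.card_univ, Fintype.card_fin] at this
    omega
  obtain ⟨k, hk⟩ : ∃ k, k ∉ ({0, σ 0, j, σ j} : Finset (Fin 6)) := by
    by_contra! h
    have := Finset.card_le_card (fun x _ => h x : (Finset.univ : Finset (Fin 6)) ⊆ _)
    have h2 := Finset.card_le_four (a := 0) (b := σ 0) (c := j) (d := σ j)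
    simp only [Finset.card_univ, Fintype.card_fin] at this
    omega
  simp only [Finset.mem_insert, Finset.mem_singleton, not_or] at hj hk
  have hinj : Function.Injective ![0, σ 0, j, σ j, k, σ k] := by
    have h0 := hfix 0
    have h1 := hfix j
    have h2 := hfix k
    have i0 := hinv 0
    have i1 := hinv j
    have i2 := hinv k
    intro x y hxy
    fin_cases x <;> fin_cases y <;> simp at hxy ⊢ <;> grind
  exact ⟨Equiv.ofBijective _ (Finite.injective_iff_bijective.mp hinj), rfl, rfl, rfl⟩

/-- Direction of a line of the Segre primal through `(a, -a, b, -b, c, -c)`, for `ε = ±1`. -/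
def transversal (ε a b c : ℂ) : Fin 6 → ℂ :=
  ![b ^ 2 - c ^ 2 + ε * (b * c), b ^ 2 - c ^ 2 - ε * (b * c),
    c ^ 2 - a ^ 2 + ε * (c * a), c ^ 2 - a ^ 2 - ε * (c * a),
    a ^ 2 - b ^ 2 + ε * (a * b), a ^ 2 - b ^ 2 - ε * (a * b)]

/-- `(a, b, c)` and `(bc, ca, ab)` span the orthogonal complement of `(a, b, c)` for the quadratic
form with coefficients `b² - c²`, `c² - a²`, `a² - b²`. -/
theorem orthogonal_eq_combination {a b c x y z : ℂ} (hc : c ≠ 0) (hab : a ^ 2 - b ^ 2 ≠ 0)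
    (h : (b ^ 2 - c ^ 2) * a * x + (c ^ 2 - a ^ 2) * b * y + (a ^ 2 - b ^ 2) * c * z = 0) :
    ∃ m n : ℂ, x = m * a + n * (b * c) ∧ y = m * b + n * (c * a) ∧ z = m * c + n * (a * b) := by
  refine ⟨(a * x - b * y) / (a ^ 2 - b ^ 2), (a * y - b * x) / (c * (a ^ 2 - b ^ 2)), ?_, ?_, ?_⟩
  · field_simp
    ring
  · field_simp
    ring
  · field_simp
    linear_combination h

/-- Cyclically symmetric version of `orthogonal_eq_combination`. -/
theorem orthogonal_eq_combination_of_ne_zero {a b c x y z : ℂ} (h0 : a ≠ 0 ∨ b ≠ 0 ∨ c ≠ 0)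
    (hbc : b ^ 2 - c ^ 2 ≠ 0) (hca : c ^ 2 - a ^ 2 ≠ 0) (hab : a ^ 2 - b ^ 2 ≠ 0)
    (h : (b ^ 2 - c ^ 2) * a * x + (c ^ 2 - a ^ 2) * b * y + (a ^ 2 - b ^ 2) * c * z = 0) :
    ∃ m n : ℂ, x = m * a + n * (b * c) ∧ y = m * b + n * (c * a) ∧ z = m * c + n * (a * b) := by
  rcases h0 with h0 | h0 | h0
  · obtain ⟨m, n, h1, h2, h3⟩ := orthogonal_eq_combination (a := b) (b := c) (c := a)
      (x := y) (y := z) (z := x) h0 hbc (by linear_combination h)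
    exact ⟨m, n, h3, h1, h2⟩
  · obtain ⟨m, n, h1, h2, h3⟩ := orthogonal_eq_combination (a := c) (b := a) (c := b)
      (x := z) (y := x) (z := y) h0 hca (by linear_combination h)
    exact ⟨m, n, h2, h3, h1⟩
  · exact orthogonal_eq_combination h0 hab h

/-- The conditions for `p + t v` to lie on the Segre primal for all `t`, in terms of the symmetric
parts `s` and antisymmetric parts `d` of `v`, force `v` into the span of `p` and a transversal. -/
theorem line_direction {a b c s₁ s₂ s₃ d₁ d₂ d₃ : ℂ} (h0 : a ≠ 0 ∨ b ≠ 0 ∨ c ≠ 0)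
    (hbc : b ^ 2 - c ^ 2 ≠ 0) (hca : c ^ 2 - a ^ 2 ≠ 0) (hab : a ^ 2 - b ^ 2 ≠ 0)
    (hs : ¬ (s₁ = 0 ∧ s₂ = 0 ∧ s₃ = 0))
    (h1 : s₁ + s₂ + s₃ = 0) (h2 : a ^ 2 * s₁ + b ^ 2 * s₂ + c ^ 2 * s₃ = 0)
    (h3 : a * s₁ * d₁ + b * s₂ * d₂ + c * s₃ * d₃ = 0)
    (h4 : s₁ * s₂ * s₃ + s₁ * d₁ ^ 2 + s₂ * d₂ ^ 2 + s₃ * d₃ ^ 2 = 0) :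
    ∃ l m ε : ℂ, l ≠ 0 ∧ (ε = 1 ∨ ε = -1) ∧
      s₁ = l * (b ^ 2 - c ^ 2) ∧ s₂ = l * (c ^ 2 - a ^ 2) ∧ s₃ = l * (a ^ 2 - b ^ 2) ∧
      d₁ = m * a + l * ε * (b * c) ∧ d₂ = m * b + l * ε * (c * a) ∧
      d₃ = m * c + l * ε * (a * b) := by
  obtain ⟨l, hl⟩ : ∃ l, s₁ = l * (b ^ 2 - c ^ 2) := ⟨s₁ / (b ^ 2 - c ^ 2), by field_simp⟩
  have e2 : s₂ = l * (c ^ 2 - a ^ 2) := by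
    apply mul_left_cancel₀ hbc
    linear_combination h2 - c ^ 2 * h1 - (a ^ 2 - c ^ 2) * hl
  have e3 : s₃ = l * (a ^ 2 - b ^ 2) := by linear_combination h1 - hl - e2
  have hl0 : l ≠ 0 := by
    rintro rfl
    exact hs ⟨by simpa using hl, by simpa using e2, by simpa using e3⟩
  subst hl e2 e3
  obtain ⟨m, n, rfl, rfl, rfl⟩ := orthogonal_eq_combination_of_ne_zero (x := d₁) (y := d₂)
    (z := d₃) h0 hbc hca hab (by apply mul_left_cancel₀ hl0; linear_combination h3)
  have hn : (n - l) * (n + l) = 0 := by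
    apply mul_left_cancel₀ (mul_ne_zero hl0 (mul_ne_zero hbc (mul_ne_zero hca hab)))
    linear_combination -h4
  rcases mul_eq_zero.mp hn with hn | hn
  · exact ⟨l, m, 1, hl0, Or.inl rfl, rfl, rfl, rfl, by linear_combination b * c * hn,
      by linear_combination c * a * hn, by linear_combination a * b * hn⟩
  · exact ⟨l, m, -1, hl0, Or.inr rfl, rfl, rfl, rfl, by linear_combination b * c * hn,
      by linear_combination c * a * hn, by linear_combination a * b * hn⟩

/-- The two transversals through a point with distinct squares of coordinates are independent
modulo the point. -/
theorem transversal_independent {a b c α β : ℂ} (h0 : a ≠ 0 ∨ b ≠ 0 ∨ c ≠ 0)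
    (hbc : b ^ 2 - c ^ 2 ≠ 0) (hca : c ^ 2 - a ^ 2 ≠ 0) (hab : a ^ 2 - b ^ 2 ≠ 0)
    (h1 : α * a = β * (b * c)) (h2 : α * b = β * (c * a)) (h3 : α * c = β * (a * b)) :
    β = 0 := by
  by_contra hβ
  have ha : a = 0 := by
    apply mul_left_cancel₀ (mul_ne_zero hβ hbc)
    linear_combination c * h2 - b * h3
  have hb : b = 0 := by
    apply mul_left_cancel₀ (mul_ne_zero hβ hca)
    linear_combination a * h3 - c * h1
  have hc : c = 0 := by
    apply mul_left_cancel₀ (mul_ne_zero hβ hab)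
    linear_combination b * h1 - a * h2
  simp_all


/-- Let `M` be a perfect matching of `{0,…,5}` (a fixed-point-free involution
`σ`, pairs `{i, σ i}`) and `p ∈ P_M` nonzero such that `[p]` is not a singular point of the
Segre primal `X₀` (not all `pᵢ²` equal) and `[p]` lies on no other plane `ℙ(P_{M'})`. Then:
(a) every projective line through `[p]` contained in the plane `ℙ(P_M)` is contained in `X₀`;
(b) there are exactly 2 two-dimensional subspaces `L ⊆ ℂ^6` with `p ∈ L`, `L` inside the
affine cone of `X₀`, and `L ⊄ P_M`. So the lines of `X₀` through `[p]` are the pencil of lines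
through `[p]` in `ℙ(P_M)` plus two more lines not in that plane. -/
theorem stmt_15 (σ : Equiv.Perm (Fin 6)) (hfix : ∀ i, σ i ≠ i) (hinv : ∀ i, σ (σ i) = i)
    (p : Fin 6 → ℂ) (hp : p ≠ 0) (hpM : ∀ i, p i + p (σ i) = 0)
    (hsing : ¬ ∀ i j, p i ^ 2 = p j ^ 2)
    (hother : ∀ σ' : Equiv.Perm (Fin 6), (∀ i, σ' i ≠ i) → (∀ i, σ' (σ' i) = i) →
      σ' ≠ σ → ¬ ∀ i, p i + p (σ' i) = 0) :
    (∀ L : Submodule ℂ (Fin 6 → ℂ), Module.finrank ℂ L = 2 → p ∈ L →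
      (∀ x ∈ L, ∀ i, x i + x (σ i) = 0) →
      ∀ x ∈ L, ∑ i, x i = 0 ∧ ∑ i, x i ^ 3 = 0) ∧
    {L : Submodule ℂ (Fin 6 → ℂ) | Module.finrank ℂ L = 2 ∧ p ∈ L ∧
      (∀ x ∈ L, ∑ i, x i = 0 ∧ ∑ i, x i ^ 3 = 0) ∧
      ¬ ∀ x ∈ L, ∀ i, x i + x (σ i) = 0}.ncard = 2 := by
  obtain ⟨e, e0, e2, e4⟩ := exists_adapted_equiv σ hfix hinv
  have e1 : σ (e 1) = e 0 := by rw [← e0, hinv]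
  have e3 : σ (e 3) = e 2 := by rw [← e2, hinv]
  have e5 : σ (e 5) = e 4 := by rw [← e4, hinv]
  have hsum : ∀ f : Fin 6 → ℂ,
      ∑ i, f i = f (e 0) + f (e 1) + f (e 2) + f (e 3) + f (e 4) + f (e 5) := fun f => by
    rw [← e.sum_comp, Fin.sum_univ_six]
  have hforall : ∀ P : Fin 6 → Prop,
      (∀ i, P i) ↔ P (e 0) ∧ P (e 1) ∧ P (e 2) ∧ P (e 3) ∧ P (e 4) ∧ P (e 5) := fun P => by
    rw [← e.forall_congr_right, Fin.forall_fin_succ, Fin.forall_fin_succ, Fin.forall_fin_succ,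
      Fin.forall_fin_succ, Fin.forall_fin_succ, Fin.forall_fin_one]
    rfl
  have hplane : ∀ x : Fin 6 → ℂ, (∀ i, x i + x (σ i) = 0) ↔
      x (e 0) + x (e 1) = 0 ∧ x (e 2) + x (e 3) = 0 ∧ x (e 4) + x (e 5) = 0 := fun x => by
    rw [hforall, e0, e1, e2, e3, e4, e5, add_comm (x (e 1)), add_comm (x (e 3)),
      add_comm (x (e 5))]
    tauto
  have hsq : ∀ i j, j ≠ i → j ≠ σ i → p i ^ 2 - p j ^ 2 ≠ 0 := by
    intro i j hi hj h
    rcases mul_eq_zero.mp (show (p i + p j) * (p i - p j) = 0 by linear_combination h) with h | h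
    · obtain ⟨σ', h1, h2, h3, h4⟩ := exists_other_matching σ hfix hinv p hpM hi hj h
      exact hother σ' h1 h2 h3 h4
    · obtain ⟨σ', h1, h2, h3, h4⟩ := exists_other_matching σ hfix hinv p hpM (i := i) (j := σ j)
        (fun h' => hj (by rw [← h', hinv])) (fun h' => hi (σ.injective h'))
        (by linear_combination h + hpM j)
      exact hother σ' h1 h2 h3 h4
  have hab := hsq (e 0) (e 2) (by simp) (by rw [e0]; simp)
  have hbc := hsq (e 2) (e 4) (by simp) (by rw [e2]; simp)
  have hca := hsq (e 4) (e 0) (by simp) (by rw [e4]; simp)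
  obtain ⟨p1, p3, p5⟩ := (hplane p).mp hpM
  have h0 : p (e 0) ≠ 0 ∨ p (e 2) ≠ 0 ∨ p (e 4) ≠ 0 := by
    by_contra! h
    apply hp
    funext i
    revert i
    rw [hforall]
    simp_all
  replace p1 : p (e 1) = -p (e 0) := by linear_combination p1
  replace p3 : p (e 3) = -p (e 2) := by linear_combination p3
  replace p5 : p (e 5) = -p (e 4) := by linear_combination p5
  set a := p (e 0) with ha
  set b := p (e 2) with hb
  set c := p (e 4) with hc
  refine ⟨fun L _ _ hL x hx => ?_, ?_⟩
  · obtain ⟨x1, x3, x5⟩ := (hplane x).mp (hL x hx)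
    rw [hsum, hsum, eq_neg_of_add_eq_zero_right x1, eq_neg_of_add_eq_zero_right x3,
      eq_neg_of_add_eq_zero_right x5]
    constructor <;> ring
  obtain ⟨v, hv⟩ : ∃ v : ℂ → Fin 6 → ℂ, ∀ ε i, v ε (e i) = transversal ε a b c i :=
    ⟨fun ε i => transversal ε a b c (e.symm i), fun ε i => by simp⟩
  have v0 : ∀ ε, v ε (e 0) = b ^ 2 - c ^ 2 + ε * (b * c) := fun ε => hv ε 0
  have v1 : ∀ ε, v ε (e 1) = b ^ 2 - c ^ 2 - ε * (b * c) := fun ε => hv ε 1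
  have v2 : ∀ ε, v ε (e 2) = c ^ 2 - a ^ 2 + ε * (c * a) := fun ε => hv ε 2
  have v3 : ∀ ε, v ε (e 3) = c ^ 2 - a ^ 2 - ε * (c * a) := fun ε => hv ε 3
  have v4 : ∀ ε, v ε (e 4) = a ^ 2 - b ^ 2 + ε * (a * b) := fun ε => hv ε 4
  have v5 : ∀ ε, v ε (e 5) = a ^ 2 - b ^ 2 - ε * (a * b) := fun ε => hv ε 5
  have hind : ∀ w : Fin 6 → ℂ, (¬ ∀ i, w i + w (σ i) = 0) →
      Module.finrank ℂ (Submodule.span ℂ {p, w}) = 2 := by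
    intro w hw
    have hli : LinearIndependent ℂ ![p, w] := by
      rw [LinearIndependent.pair_iff]
      intro s t hst
      have ht : t = 0 := by
        by_contra ht
        refine hw fun i => ?_
        have h1 := congrFun hst i
        have h2 := congrFun hst (σ i)
        simp only [Pi.add_apply, Pi.smul_apply, smul_eq_mul, Pi.zero_apply] at h1 h2
        apply mul_left_cancel₀ ht
        linear_combination h1 + h2 - s * hpM i
      subst ht
      simpa [hp] using hst
    have := finrank_span_eq_card hli
    rwa [Matrix.range_cons_cons_empty, Fintype.card_fin] at this
  have hvP : ∀ ε, ¬ ∀ i, v ε i + v ε (σ i) = 0 := by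
    intro ε h
    have := ((hplane _).mp h).1
    rw [v0, v1] at this
    exact hbc (by linear_combination this / 2)
  have hset : {L : Submodule ℂ (Fin 6 → ℂ) | Module.finrank ℂ L = 2 ∧ p ∈ L ∧
      (∀ x ∈ L, ∑ i, x i = 0 ∧ ∑ i, x i ^ 3 = 0) ∧
      ¬ ∀ x ∈ L, ∀ i, x i + x (σ i) = 0} =
      {Submodule.span ℂ {p, v 1}, Submodule.span ℂ {p, v (-1)}} := by
    ext L
    simp only [Set.mem_ofPred_eq, Set.mem_insert_iff, Set.mem_singleton_iff]
    constructor
    · rintro ⟨hL2, hpL, hLX, hLP⟩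
      obtain ⟨w, hwL, hwP⟩ : ∃ w ∈ L, ¬ ∀ i, w i + w (σ i) = 0 := by
        by_contra! h
        exact hLP h
      have hw := hLX w hwL
      have hadd := (hLX _ (L.add_mem hwL hpL)).2
      have hsub := (hLX _ (L.sub_mem hwL hpL)).2
      rw [hplane] at hwP
      simp only [hsum, Pi.add_apply, Pi.sub_apply, p1, p3, p5, ← ha, ← hb, ← hc]
        at hw hadd hsub
      obtain ⟨hw1, hw3⟩ := hw
      obtain ⟨l, m, ε, hl, hε, s1, s2, s3, d1, d2, d3⟩ := line_direction
        (s₁ := (w (e 0) + w (e 1)) / 2) (s₂ := (w (e 2) + w (e 3)) / 2)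
        (s₃ := (w (e 4) + w (e 5)) / 2) (d₁ := (w (e 0) - w (e 1)) / 2)
        (d₂ := (w (e 2) - w (e 3)) / 2) (d₃ := (w (e 4) - w (e 5)) / 2)
        h0 hbc hca hab (by simpa using hwP) (by linear_combination hw1 / 2)
        (by linear_combination (hadd + hsub - 2 * hw3) / 12)
        (by linear_combination (hadd - hsub) / 24) (by
          have sum3 : ∀ x y z : ℂ, x * y * z = (x ^ 3 + y ^ 3 + z ^ 3) / 3 -
              (x + y + z) * (x ^ 2 + y ^ 2 + z ^ 2 - x * y - y * z - z * x) / 3 := by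
            intros
            ring
          rw [sum3, show (w (e 0) + w (e 1)) / 2 + (w (e 2) + w (e 3)) / 2 +
            (w (e 4) + w (e 5)) / 2 = 0 by linear_combination hw1 / 2]
          linear_combination hw3 / 6)
      have hwe : w = m • p + l • v ε := by
        funext i
        revert i
        rw [hforall]
        simp only [Pi.add_apply, Pi.smul_apply, smul_eq_mul, p1, p3, p5, ← ha, ← hb, ← hc,
          v0, v1, v2, v3, v4, v5]
        exact ⟨by linear_combination s1 + d1, by linear_combination s1 - d1,
          by linear_combination s2 + d2, by linear_combination s2 - d2,
          by linear_combination s3 + d3, by linear_combination s3 - d3⟩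
      have hvL : v ε ∈ L := by
        rw [← L.smul_mem_iff hl, ← L.add_mem_iff_right (L.smul_mem m hpL), ← hwe]
        exact hwL
      have hLe : L = Submodule.span ℂ {p, v ε} := by
        refine (Submodule.eq_of_le_of_finrank_eq ?_ ?_).symm
        · rw [Submodule.span_le]
          rintro x (rfl | rfl) <;> assumption
        · rw [hL2, hind _ (hvP ε)]
      rcases hε with rfl | rfl
      · exact Or.inl hLe
      · exact Or.inr hLe
    · intro hL
      obtain ⟨ε, hε, rfl⟩ : ∃ ε : ℂ, ε ^ 2 = 1 ∧ L = Submodule.span ℂ {p, v ε} := by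
        rcases hL with h | h
        · exact ⟨1, by norm_num, h⟩
        · exact ⟨-1, by norm_num, h⟩
      refine ⟨hind _ (hvP ε), Submodule.subset_span (by simp), fun x hx => ?_,
        fun h => hvP ε (h _ (Submodule.subset_span (by simp)))⟩
      obtain ⟨α, β, rfl⟩ := Submodule.mem_span_pair.mp hx
      simp only [hsum, Pi.add_apply, Pi.smul_apply, smul_eq_mul, p1, p3, p5, ← ha, ← hb, ← hc,
          v0, v1, v2, v3, v4, v5]
      refine ⟨by ring, ?_⟩
      linear_combination (6 * β ^ 3 * ((b ^ 2 - c ^ 2) * (b * c) ^ 2 +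
        (c ^ 2 - a ^ 2) * (c * a) ^ 2 + (a ^ 2 - b ^ 2) * (a * b) ^ 2)) * hε
  rw [hset, Set.ncard_pair]
  intro h
  have hmem : v (-1) ∈ Submodule.span ℂ {p, v 1} := by
    rw [h]
    exact Submodule.subset_span (by simp)
  obtain ⟨α, β, hαβ⟩ := Submodule.mem_span_pair.mp hmem
  have hcoord := fun i => congrFun hαβ i
  rw [hforall] at hcoord
  simp only [Pi.add_apply, Pi.smul_apply, smul_eq_mul, p1, p3, p5, ← ha, ← hb, ← hc,
    v0, v1, v2, v3, v4, v5] at hcoord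
  obtain ⟨c0, c1, c2, c3, c4, c5⟩ := hcoord
  have hβ : β = 1 := by
    apply mul_left_cancel₀ hbc
    linear_combination (c0 + c1) / 2
  subst hβ
  have := transversal_independent (α := α) (β := -2) h0 hbc hca hab
    (by linear_combination (c0 - c1) / 2) (by linear_combination (c2 - c3) / 2)
    (by linear_combination (c4 - c5) / 2)
  norm_num at this
end

section
/- Let q be a nondegenerate quadratic form on ℂ^5 with polar bilinear form B, and let π ⊆ ℂ^5 be a 3-dimensional linear subspace (a projective plane in ℙ^4) such that the restriction of q to the 2-dimensional orthogonal complement π^⊥ = {x : B(x,w) = 0 for all w ∈ π} is nondegenerate. Then the set of points [x] of the quadric Q = {q = 0} ⊂ ℙ(ℂ^5) whose tangent hyperplane contains ℙ(π), i.e. {[x] : q(x) = 0 and B(x,w) = 0 for all w ∈ π}, has exactly 2 elements. (For a general plane π there are exactly two points x, y of a smooth quadric threefold Q with π ⊆ T_{Q,x} ∩ T_{Q,y}.) -/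
/-- A nondegenerate binary quadratic form over `ℂ` has exactly two isotropic lines. -/
theorem QuadraticForm.exists_isotropic_pair {M : Type*} [AddCommGroup M] [Module ℂ M]
    [FiniteDimensional ℂ M] (Q : QuadraticForm ℂ M) (hM : Module.finrank ℂ M = 2)
    (hQ : ∀ v, (∀ u, QuadraticMap.polar Q v u = 0) → v = 0) :
    ∃ x y : M, x ≠ 0 ∧ y ≠ 0 ∧ (∀ c : ℂ, c • y ≠ x) ∧ Q x = 0 ∧ Q y = 0 ∧
      ∀ w, Q w = 0 → ∃ c : ℂ, c • x = w ∨ c • y = w := by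
  have hsep : (QuadraticMap.associated (R := ℂ) Q).SeparatingLeft := by
    intro v hv
    refine hQ v fun u => ?_
    have h := hv u
    rw [QuadraticMap.associated_apply] at h
    simpa [QuadraticMap.polar] using h
  have hequiv := QuadraticForm.equivalent_weightedSumSquares_of_isAlgClosed Q hsep
  rw [hM] at hequiv
  obtain ⟨f⟩ := hequiv
  have hf : ∀ w, Q w = f w 0 * f w 0 + f w 1 * f w 1 := fun w => by
    rw [← f.map_app w, QuadraticMap.weightedSumSquares_apply]
    simp [Fin.sum_univ_two]
  have hI := Complex.I_mul_I
  let g : (Fin 2 → ℂ) → M := f.toLinearEquiv.symm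
  have hfg : ∀ v, f (g v) = v := fun v => f.toLinearEquiv.apply_symm_apply v
  have hinj : Function.Injective f := f.toLinearEquiv.injective
  have hsmul : ∀ (c : ℂ) w, f (c • w) = c • f w := fun c w => f.toLinearEquiv.map_smul c w
  have hzero : f 0 = 0 := f.toLinearEquiv.map_zero
  have hne : ∀ a : ℂ, g ![1, a] ≠ 0 := fun a h => by
    have h0 := hfg ![1, a]
    rw [h, hzero] at h0
    simpa using congrFun h0 0
  refine ⟨g ![1, Complex.I], g ![1, -Complex.I], hne _, hne _, ?_, ?_, ?_, ?_⟩
  · intro c h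
    have h' := congrArg f h
    rw [hsmul, hfg, hfg] at h'
    have h0 : c = 1 := by simpa using congrFun h' 0
    have h1 : -(c * Complex.I) = Complex.I := by simpa using congrFun h' 1
    subst h0
    have : Complex.I = 0 := by linear_combination -h1 / 2
    exact Complex.I_ne_zero this
  · simp [hf, hfg]
  · simp [hf, hfg]
  · intro w hw
    rw [hf] at hw
    have hprod : (f w 1 - f w 0 * Complex.I) * (f w 1 + f w 0 * Complex.I) = 0 := by
      linear_combination hw - f w 0 * f w 0 * hI
    refine ⟨f w 0, (mul_eq_zero.mp hprod).imp (fun h => ?_) fun h => ?_⟩ <;>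
    · apply hinj
      rw [hsmul, hfg]
      ext i
      fin_cases i
      · simp
      · simp only [Fin.mk_one, Pi.smul_apply, smul_eq_mul, Matrix.cons_val_one,
          Matrix.cons_val_fin_one]
        linear_combination -h


/-- Let `q` be a nondegenerate quadratic form on `ℂ^5` with polar form
`B(u,v) = q(u+v) - q(u) - q(v)`, and let `π ⊆ ℂ^5` be a 3-dimensional subspace (a projective
plane in `ℙ^4`) such that the restriction of `q` to the orthogonal complement
`π^⊥ = {x : B(x,w) = 0 for all w ∈ π}` is nondegenerate. Then there are exactly 2 points `[x]`
of the quadric `Q = {q = 0} ⊆ ℙ(ℂ^5)` whose tangent hyperplane contains `ℙ(π)`, i.e. with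
`q(x) = 0` and `B(x,w) = 0` for all `w ∈ π`. -/
theorem stmt_17 (q : QuadraticForm ℂ (Fin 5 → ℂ))
    (hnd : ∀ v : Fin 5 → ℂ, (∀ w, QuadraticMap.polar (⇑q) v w = 0) → v = 0)
    (π : Submodule ℂ (Fin 5 → ℂ)) (hπ : Module.finrank ℂ π = 3)
    (hperp : ∀ v : Fin 5 → ℂ, (∀ w ∈ π, QuadraticMap.polar (⇑q) v w = 0) →
      (∀ u : Fin 5 → ℂ, (∀ w ∈ π, QuadraticMap.polar (⇑q) u w = 0) →
        QuadraticMap.polar (⇑q) v u = 0) → v = 0) :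
    {P : Projectivization ℂ (Fin 5 → ℂ) | ∃ x : Fin 5 → ℂ, ∃ hx : x ≠ 0,
      P = Projectivization.mk ℂ x hx ∧ q x = 0 ∧
      ∀ w ∈ π, QuadraticMap.polar (⇑q) x w = 0}.ncard = 2 := by
  have hB : q.polarBilin.Nondegenerate := by
    refine ⟨fun v hv => hnd v hv, fun v hv => hnd v fun w => ?_⟩
    rw [QuadraticMap.polar_comm]
    exact hv w
  set W := LinearMap.BilinForm.orthogonal q.polarBilin π with hW
  have hmem : ∀ v, v ∈ W ↔ ∀ w ∈ π, QuadraticMap.polar q v w = 0 := fun v => by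
    rw [hW, LinearMap.BilinForm.mem_orthogonal_iff]
    refine forall₂_congr fun w _ => ?_
    rw [QuadraticMap.polar_comm]
    rfl
  have hdim : Module.finrank ℂ W = 2 := by
    rw [hW, LinearMap.BilinForm.finrank_orthogonal hB, hπ]
    simp
  obtain ⟨x, y, hx, hy, hxy, hqx, hqy, hall⟩ :=
    QuadraticForm.exists_isotropic_pair (q.comp W.subtype) hdim fun v hv =>
      Subtype.ext <| hperp v ((hmem v).1 v.2) fun u hu => hv ⟨u, (hmem u).2 hu⟩
  have hx' : (x : Fin 5 → ℂ) ≠ 0 := by simpa using hx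
  have hy' : (y : Fin 5 → ℂ) ≠ 0 := by simpa using hy
  rw [Set.ncard_eq_two]
  refine ⟨.mk ℂ x hx', .mk ℂ y hy', ?_, ?_⟩
  · rw [Ne, Projectivization.mk_eq_mk_iff']
    rintro ⟨c, hc⟩
    exact hxy c (Subtype.ext hc)
  · ext P
    simp only [Set.mem_ofPred_eq, Set.mem_insert_iff, Set.mem_singleton_iff]
    constructor
    · rintro ⟨z, hz, rfl, hqz, hzπ⟩
      obtain ⟨c, hc⟩ := hall ⟨z, (hmem z).2 hzπ⟩ hqz
      simp only [Projectivization.mk_eq_mk_iff']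
      exact hc.imp (fun h => ⟨c, congrArg Subtype.val h⟩) fun h => ⟨c, congrArg Subtype.val h⟩
    · rintro (rfl | rfl)
      · exact ⟨x, hx', rfl, hqx, (hmem x).1 x.2⟩
      · exact ⟨y, hy', rfl, hqy, (hmem y).1 y.2⟩
end
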